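/- There exist a field F and a continuous homomorphism ρ : Gal(F_s/F) → GL_5(𝔽_2) that admits no lift to a continuous homomorphism Gal(F_s/F) → GL_5(ℤ/4) along the reduction ℤ/4 → ℤ/2. -/

import Mathlib

open scoped MatrixGroups

/-- The absolute Galois group `Gal(F_s/F)`, with its Krull topology. -/
abbrev AbsGal (F : Type) [Field F] : Type :=
  SeparableClosure F ≃ₐ[F] SeparableClosure F

/-- A group of order 32, an extension of `(ZMod 2)²` by `(ZMod 2)³`. -/
@[ext] structure Grp where
  u1 : ZMod 2
  u2 : ZMod 2
  p : ZMod 2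
  q : ZMod 2
  r : ZMod 2
deriving DecidableEq, Fintype

namespace Grp

instance : Mul Grp := ⟨fun a b => ⟨a.u1 + b.u1, a.u2 + b.u2, a.p + b.p + a.u1 * b.u1,
  a.q + b.q + a.u2 * b.u2, a.r + b.r + a.u2 * b.u1⟩⟩
instance : One Grp := ⟨⟨0, 0, 0, 0, 0⟩⟩
instance : Inv Grp := ⟨fun a => ⟨a.u1, a.u2, a.p + a.u1, a.q + a.u2, a.r + a.u1 * a.u2⟩⟩

theorem mul_def (a b : Grp) : a * b = ⟨a.u1 + b.u1, a.u2 + b.u2, a.p + b.p + a.u1 * b.u1,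
  a.q + b.q + a.u2 * b.u2, a.r + b.r + a.u2 * b.u1⟩ := rfl
theorem one_def : (1 : Grp) = ⟨0, 0, 0, 0, 0⟩ := rfl

instance : Group Grp := Group.ofLeftAxioms
  (fun a b c => by ext <;> simp only [mul_def] <;> ring)
  (fun a => by ext <;> simp [mul_def, one_def])
  (by decide)

def x : Grp := ⟨1, 0, 0, 0, 0⟩
def y : Grp := ⟨0, 1, 0, 0, 0⟩

/-- A unipotent matrix representation of the group. -/
def mat (g : Grp) : Matrix (Fin 5) (Fin 5) (ZMod 2) :=
  !![1, 0, g.u1, g.p, g.r + g.u1 * g.u2;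
     0, 1, g.u2, g.r, g.q;
     0, 0, 1, g.u1, g.u2;
     0, 0, 0, 1, 0;
     0, 0, 0, 0, 1]

def matHom : Grp →* Matrix (Fin 5) (Fin 5) (ZMod 2) where
  toFun := mat
  map_one' := by decide
  map_mul' a b := by
    ext i j
    fin_cases i <;> fin_cases j <;>
      simp [mat, mul_def, Matrix.mul_apply, Fin.sum_univ_five] <;> ring_nf <;> reduce_mod_char

@[simp] theorem u1_mul (a b : Grp) : (a * b).u1 = a.u1 + b.u1 := rfl
@[simp] theorem u2_mul (a b : Grp) : (a * b).u2 = a.u2 + b.u2 := rfl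
@[simp] theorem u1_inv (a : Grp) : (a⁻¹).u1 = a.u1 := rfl
@[simp] theorem u2_inv (a : Grp) : (a⁻¹).u2 = a.u2 := rfl
@[simp] theorem u1_one : (1 : Grp).u1 = 0 := rfl
@[simp] theorem u2_one : (1 : Grp).u2 = 0 := rfl

end Grp

abbrev Mat5 : Type := Matrix (Fin 5) (Fin 5) (ZMod 2)

namespace Grp

theorem matHom_mul_inv (g : Grp) : matHom g * matHom g⁻¹ = 1 := by
  rw [← map_mul, mul_inv_cancel, map_one]
theorem matHom_inv_mul (g : Grp) : matHom g⁻¹ * matHom g = 1 := by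
  rw [← map_mul, inv_mul_cancel, map_one]

instance : DistribMulAction Grp Mat5 where
  smul g a := matHom g * a * matHom g⁻¹
  one_smul a := by change matHom 1 * a * matHom 1⁻¹ = a; simp
  mul_smul g h a := by
    change matHom (g * h) * a * matHom (g * h)⁻¹ =
      matHom g * (matHom h * a * matHom h⁻¹) * matHom g⁻¹
    simp only [map_mul, mul_inv_rev, mul_assoc]
  smul_zero g := by change matHom g * 0 * matHom g⁻¹ = 0; simp
  smul_add g a b := by
    change matHom g * (a + b) * matHom g⁻¹ = matHom g * a * matHom g⁻¹ + matHom g * b * matHom g⁻¹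
    rw [mul_add, add_mul]

theorem smul_def (g : Grp) (a : Mat5) : g • a = mat g * a * mat g⁻¹ := rfl

theorem inv_def (a : Grp) : a⁻¹ = ⟨a.u1, a.u2, a.p + a.u1, a.q + a.u2, a.r + a.u1 * a.u2⟩ := rfl

def J : Grp := ⟨0, 0, 0, 0, 1⟩

theorem commute_of_fixed {g : Grp} {b : Mat5} (h : g • b = b) : mat g * b = b * mat g := by
  change matHom g * b = b * matHom g
  conv_rhs => rw [← h]
  change _ = matHom g * b * matHom g⁻¹ * matHom g
  rw [mul_assoc, matHom_inv_mul, mul_one]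

theorem linear_relation (m n : Mat5) :
    (m + x • m + (x * x) • m + (x * x * x) • m) 0 3 +
    ((m + x • m + (x * x) • n) - (n + y • (m + x • m))) 1 2 +
    ((m + x • (n + y • n)) - (n + y • n + (y * y) • m)) 3 4 = 0 := by
  simp only [smul_def, Matrix.mul_apply, Fin.sum_univ_five, Matrix.add_apply, Matrix.sub_apply]
  simp [mat, x, y, inv_def, mul_def]
  ring_nf
  reduce_mod_char

theorem xx_smul_34 (b : Mat5) : ((x * x) • b) 3 4 = b 3 4 := by
  simp only [smul_def, Matrix.mul_apply, Fin.sum_univ_five]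
  simp [mat, x, inv_def, mul_def]

theorem entry_34_of_fixed (b : Mat5) (h : (x * x) • b = b) : b 3 4 = 0 := by
  have := congrFun (congrFun (commute_of_fixed h) 0) 4
  simp only [Matrix.mul_apply, Fin.sum_univ_five] at this
  simp [mat, x, mul_def] at this
  grind

theorem entry_of_fixed_N (b : Mat5) (hx : (x * x) • b = b) (hy : y • b = b) (hJ : J • b = b) :
    (b + x • b) 0 3 = 0 := by
  have e := fun i j => congrFun (congrFun (commute_of_fixed hx) i) j
  have f := fun i j => congrFun (congrFun (commute_of_fixed hy) i) j
  have k := fun i j => congrFun (congrFun (commute_of_fixed hJ) i) j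
  simp only [smul_def, Matrix.mul_apply, Fin.sum_univ_five, Matrix.add_apply, mul_def,
    x, y, J] at e f k ⊢
  have e1 := e 0 3
  have f1 := f 0 4
  have f2 := f 1 3
  have f3 := f 1 2
  have k1 := k 0 4
  have k2 := k 1 3
  have e2 := e 2 3
  have e3 := e 0 2
  simp [mat, inv_def] at *
  grind

theorem entry_of_fixed_M (b : Mat5) (hx : (x * x) • b = b) (hxy : (x * y) • b = b)
    (hy : (y * y) • b = b) (hJ : J • b = b) :
    (b + x • b) 0 3 + (b + x • b) 1 2 = 0 := by
  have e := fun i j => congrFun (congrFun (commute_of_fixed hx) i) j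
  have f := fun i j => congrFun (congrFun (commute_of_fixed hxy) i) j
  have k := fun i j => congrFun (congrFun (commute_of_fixed hJ) i) j
  have l := fun i j => congrFun (congrFun (commute_of_fixed hy) i) j
  simp only [smul_def, Matrix.mul_apply, Fin.sum_univ_five, Matrix.add_apply, mul_def,
    x, y, J] at e f k l ⊢
  simp [Fin.forall_fin_succ, mat, inv_def] at e f k l ⊢
  grind
end Grp

namespace Grp

/-- The additive map `ZMod 2 → ZMod 4` with image the kernel of reduction. -/
def dbl : ZMod 2 →+ ZMod 4 where
  toFun a := if a = 0 then 0 else 2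
  map_zero' := rfl
  map_add' := by decide

abbrev red : ZMod 4 →+* ZMod 2 := ZMod.castHom (by norm_num : (2 : ℕ) ∣ 4) (ZMod 2)

theorem dbl_injective : Function.Injective dbl := by decide
theorem dbl_mul_dbl (a b : ZMod 2) : dbl a * dbl b = 0 := by revert a b; decide
theorem mul_dbl (z : ZMod 4) (a : ZMod 2) : z * dbl a = dbl (red z * a) := by
  revert z a; decide
theorem exists_dbl (z : ZMod 4) (h : red z = 0) : ∃ a, z = dbl a := by
  revert z; decide

abbrev Mat54 : Type := Matrix (Fin 5) (Fin 5) (ZMod 4)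

def dblM : Mat5 →+ Mat54 := dbl.mapMatrix

theorem dblM_apply (a : Mat5) (i j) : dblM a i j = dbl (a i j) := rfl

abbrev redM : Mat54 →+* Mat5 := red.mapMatrix

theorem dblM_injective : Function.Injective dblM := fun a b h => by
  ext i j; exact dbl_injective (congrFun (congrFun h i) j)

theorem dblM_mul_dblM (a b : Mat5) : dblM a * dblM b = 0 := by
  ext i j; simp [Matrix.mul_apply, dblM_apply, dbl_mul_dbl]

theorem mul_dblM (z : Mat54) (a : Mat5) : z * dblM a = dblM (redM z * a) := by
  ext i j; simp only [Matrix.mul_apply, dblM_apply, mul_dbl, map_sum]; rfl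

theorem dblM_mul (z : Mat54) (a : Mat5) : dblM a * z = dblM (a * redM z) := by
  ext i j
  simp only [Matrix.mul_apply, dblM_apply, map_sum]
  exact Finset.sum_congr rfl fun k _ => by rw [mul_comm, mul_dbl, mul_comm]; rfl

theorem exists_dblM (z : Mat54) (h : redM z = 0) : ∃ a, z = dblM a := by
  choose a ha using fun i j => exists_dbl (z i j) (congrFun (congrFun h i) j)
  exact ⟨Matrix.of a, by ext i j; exact ha i j⟩

theorem one_add_dblM_mul (a b : Mat5) : (1 + dblM a) * (1 + dblM b) = 1 + dblM (a + b) := by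
  rw [mul_add, add_mul, add_mul, dblM_mul_dblM, map_add]; simp [add_assoc]

theorem exists_one_add {g : Grp} {P M : Mat54} (hP : redM P = matHom g) (hM : redM M = matHom g) :
    ∃ m, M = (1 + dblM m) * P := by
  obtain ⟨a, ha⟩ := exists_dblM (M - P) (by rw [map_sub, hP, hM, sub_self])
  refine ⟨a * matHom g⁻¹, ?_⟩
  rw [add_mul, dblM_mul, hP, mul_assoc, matHom_inv_mul, mul_one, ← ha]; simp

theorem twisted_mul {g : Grp} {P Q : Mat54} (hP : redM P = matHom g) (a b : Mat5) :
    ((1 + dblM a) * P) * ((1 + dblM b) * Q) = (1 + dblM (a + g • b)) * (P * Q) := by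
  have : P * (1 + dblM b) = (1 + dblM (g • b)) * P := by
    rw [mul_add, add_mul, mul_dblM, dblM_mul, hP]
    change _ = _ + dblM (matHom g * b * matHom g⁻¹ * matHom g)
    rw [mul_assoc _ (matHom g⁻¹), matHom_inv_mul, mul_one, one_mul, mul_one]
  rw [mul_assoc, ← mul_assoc P, this, ← one_add_dblM_mul]; simp only [mul_assoc]

theorem twisted_injective {P : Mat54} {g : Grp} (hP : redM P = matHom g) {a b : Mat5}
    (h : (1 + dblM a) * P = (1 + dblM b) * P) : a = b := by
  rw [add_mul, add_mul, dblM_mul, dblM_mul, hP] at h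
  have := dblM_injective (add_left_cancel h)
  have := congrArg (· * matHom g⁻¹) this
  simpa only [mul_assoc, matHom_mul_inv, mul_one] using this

def X4 : Mat54 := !![1,0,1,0,0; 0,1,0,0,0; 0,0,1,1,0; 0,0,0,1,0; 0,0,0,0,1]
def Y4 : Mat54 := !![1,0,0,0,0; 0,1,1,0,0; 0,0,1,0,1; 0,0,0,1,0; 0,0,0,0,1]

theorem redM_X4 : redM X4 = matHom x := by decide
theorem redM_Y4 : redM Y4 = matHom y := by decide

def E14 : Mat5 := Matrix.single 0 3 1
def E15E24 : Mat5 := Matrix.single 0 4 1 + Matrix.single 1 3 1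

theorem X4_pow : X4 * X4 * X4 * X4 = (1 + dblM E14) * 1 := by decide
theorem XXY : X4 * X4 * Y4 = (1 + dblM E15E24) * (Y4 * (X4 * X4)) := by decide
theorem XYY : X4 * (Y4 * Y4) = (1 + dblM E15E24) * (Y4 * Y4 * X4) := by decide

theorem lift_relation {M N : Mat54} (hM : redM M = matHom x) (hN : redM N = matHom y)
    {c1 c4 c5 : Mat5} (h1 : M * M * M * M = 1 + dblM c1)
    (h4 : M * M * N = (1 + dblM c4) * (N * (M * M)))
    (h5 : M * (N * N) = (1 + dblM c5) * (N * N * M)) :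
    c1 0 3 + c4 1 2 + c5 3 4 = 1 := by
  obtain ⟨m, rfl⟩ := exists_one_add redM_X4 hM
  obtain ⟨n, rfl⟩ := exists_one_add redM_Y4 hN
  have hx := redM_X4
  have hy := redM_Y4
  have hxx : redM (X4 * X4) = matHom (x * x) := by rw [map_mul, map_mul, hx]
  have hyy : redM (Y4 * Y4) = matHom (y * y) := by rw [map_mul, map_mul, hy]
  have hxxx : redM (X4 * X4 * X4) = matHom (x * x * x) := by rw [map_mul, hxx, hx, ← map_mul]
  have hone : redM 1 = matHom 1 := by rw [map_one, map_one]
  rw [twisted_mul hx, twisted_mul hxx, twisted_mul hxxx, X4_pow, ← mul_assoc,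
    one_add_dblM_mul, ← mul_one (1 + dblM c1)] at h1
  rw [twisted_mul hx, twisted_mul hxx, twisted_mul hy, XXY, ← mul_assoc,
    one_add_dblM_mul, ← mul_assoc (1 + dblM c4), one_add_dblM_mul] at h4
  rw [twisted_mul hy, twisted_mul hyy, twisted_mul hx, ← mul_assoc (1 + dblM c5),
    one_add_dblM_mul, XYY, ← mul_assoc, one_add_dblM_mul] at h5
  have h1' := twisted_injective hone h1
  have h4' := twisted_injective (g := y * (x * x)) (by rw [map_mul redM, hy, hxx, ← map_mul]) h4
  have h5' := twisted_injective (g := y * y * x) (by rw [map_mul redM, hx, hyy, ← map_mul]) h5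
  have k1 := congrFun (congrFun h1' 0) 3
  have k4 := congrFun (congrFun h4' 1) 2
  have k5 := congrFun (congrFun h5' 3) 4
  have L := linear_relation m n
  have a1 : E14 0 3 = 1 := rfl
  have a4 : E15E24 1 2 = 0 := rfl
  have a5 : E15E24 3 4 = 0 := rfl
  simp only [Matrix.add_apply, Matrix.sub_apply, a1, a4, a5] at k1 k4 k5 L
  linear_combination L - k1 - k4 - k5
end Grp

/-- Complex conjugation or identity according to `u1`. -/
noncomputable def Grp.conj (g : Grp) (z : ℂ) : ℂ := if g.u1 = 0 then z else starRingEnd ℂ z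

/-- A field `K` with a semilinear group action, embedded in a field `Ω` containing its square roots,
on which a group `Γ` acts compatibly. -/
structure Tower (K Ω Γ : Type*) [Field K] [Field Ω] [Group Γ] [MulSemiringAction Grp K]
    [MulSemiringAction Γ Ω] where
  emb : K →+* Ω
  proj : Γ →* Grp
  const : ℂ →+* K
  smul_emb : ∀ γ k, γ • emb k = emb (proj γ • k)
  smul_const : ∀ (g : Grp) z, g • const z = const (g.conj z)
  exists_sqrt : ∀ k, ∃ w, w ^ 2 = emb k

/-- The sign attached to an element of `ZMod 2`. -/
def sgn (Ω : Type*) [Ring Ω] (a : ZMod 2) : Ω := if a = 0 then 1 else -1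

section sgn
variable {Ω Γ : Type*} [Field Ω] [Group Γ] [MulSemiringAction Γ Ω]

theorem sgn_zero : sgn Ω 0 = 1 := if_pos rfl
theorem sgn_one : sgn Ω 1 = -1 := if_neg (by decide)
theorem zmod2_cases (a : ZMod 2) : a = 0 ∨ a = 1 := by revert a; decide

theorem sgn_add (a b : ZMod 2) : sgn Ω (a + b) = sgn Ω a * sgn Ω b := by
  have h : (1 : ZMod 2) + 1 = 0 := rfl
  rcases zmod2_cases a with rfl | rfl <;> rcases zmod2_cases b with rfl | rfl <;>
    simp [sgn_zero, sgn_one, h]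

theorem sgn_mul_self (a : ZMod 2) : sgn Ω a * sgn Ω a = 1 := by
  rcases zmod2_cases a with rfl | rfl <;> simp [sgn_zero, sgn_one]

theorem sgn_ne_zero (a : ZMod 2) : sgn Ω a ≠ 0 := fun h => by
  have := sgn_mul_self (Ω := Ω) a; simp [h] at this

theorem smul_sgn (γ : Γ) (a : ZMod 2) : γ • sgn Ω a = sgn Ω a := by
  rcases zmod2_cases a with rfl | rfl <;> simp [sgn_zero, sgn_one]

theorem map_sgn {R : Type*} [Ring R] (f : R →+* Ω) (a : ZMod 2) : f (sgn R a) = sgn Ω a := by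
  unfold sgn; split_ifs <;> simp

theorem sgn_injective [CharZero Ω] : Function.Injective (sgn Ω) := fun a b h => by
  rcases zmod2_cases a with rfl | rfl <;> rcases zmod2_cases b with rfl | rfl <;>
    simp [sgn_zero, sgn_one] at h ⊢
  · exact absurd h.symm (by norm_num)
  · exact absurd h (by norm_num)

theorem exists_sgn {v w : Ω} (h : v ^ 2 = w ^ 2) : ∃ a, v = sgn Ω a * w := by
  rcases sq_eq_sq_iff_eq_or_eq_neg.mp h with h | h
  · exact ⟨0, by simp [sgn_zero, h]⟩
  · exact ⟨1, by simp [sgn_one, h]⟩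

end sgn

namespace Tower

variable {K Ω Γ : Type*} [Field K] [Field Ω] [Group Γ] [MulSemiringAction Grp K]
    [MulSemiringAction Γ Ω] (T : Tower K Ω Γ)

include T in
theorem charZero : CharZero Ω :=
  charZero_of_injective_ringHom (T.emb.comp T.const).injective

noncomputable def sqrt (k : K) : Ω := (T.exists_sqrt k).choose

theorem sqrt_sq (k : K) : T.sqrt k ^ 2 = T.emb k := (T.exists_sqrt k).choose_spec

open Classical in
/-- Kummer symbol: the sign by which `κ` acts on a square root of `k`. -/
noncomputable def kap (κ : Γ) (k : K) : ZMod 2 := if κ • T.sqrt k = T.sqrt k then 0 else 1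

variable {T}

theorem kap_spec {κ : Γ} (hκ : T.proj κ = 1) {k : K} {w : Ω} (hw : w ^ 2 = T.emb k) :
    κ • w = sgn Ω (T.kap κ k) * w := by
  have key : κ • T.sqrt k = sgn Ω (T.kap κ k) * T.sqrt k := by
    unfold kap
    split_ifs with h
    · simpa [sgn_zero] using h
    · have : (κ • T.sqrt k) ^ 2 = T.sqrt k ^ 2 := by
        rw [← smul_pow', sqrt_sq, smul_emb, hκ, one_smul]
      rcases sq_eq_sq_iff_eq_or_eq_neg.mp this with h' | h'
      · exact absurd h' h
      · simpa [sgn_one] using h'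
  obtain ⟨a, rfl⟩ := exists_sgn (hw.trans (sqrt_sq T k).symm)
  rw [smul_mul', smul_sgn, key]; ring

theorem ne_zero_of_sq {k : K} (hk : k ≠ 0) {w : Ω} (hw : w ^ 2 = T.emb k) : w ≠ 0 := by
  rintro rfl
  exact hk (T.emb.injective (by rw [← hw]; simp))

theorem kap_eq {κ : Γ} (hκ : T.proj κ = 1) {k : K} (hk : k ≠ 0) {w : Ω} (hw : w ^ 2 = T.emb k)
    {a : ZMod 2} (h : κ • w = sgn Ω a * w) : T.kap κ k = a := by
  have := T.charZero
  rw [kap_spec hκ hw] at h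
  exact sgn_injective (mul_right_cancel₀ (ne_zero_of_sq hk hw) h)

theorem kap_mul {κ : Γ} (hκ : T.proj κ = 1) {k l : K} (hk : k ≠ 0) (hl : l ≠ 0) :
    T.kap κ (k * l) = T.kap κ k + T.kap κ l := by
  refine kap_eq hκ (mul_ne_zero hk hl) (w := T.sqrt k * T.sqrt l) ?_ ?_
  · rw [mul_pow, sqrt_sq, sqrt_sq, map_mul]
  · rw [smul_mul', kap_spec hκ (sqrt_sq T k), kap_spec hκ (sqrt_sq T l), sgn_add]; ring

theorem kap_sq {κ : Γ} (hκ : T.proj κ = 1) {k : K} (hk : k ≠ 0) : T.kap κ (k ^ 2) = 0 := by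
  refine kap_eq hκ (pow_ne_zero 2 hk) (w := T.emb k) (by rw [map_pow]) ?_
  rw [smul_emb, hκ, one_smul, sgn_zero, one_mul]

theorem kap_one {κ : Γ} (hκ : T.proj κ = 1) : T.kap κ 1 = 0 := by
  simpa using kap_sq (T := T) hκ one_ne_zero

theorem kap_const {κ : Γ} (hκ : T.proj κ = 1) {z : ℂ} (hz : z ≠ 0) :
    T.kap κ (T.const z) = 0 := by
  obtain ⟨a, rfl⟩ := IsAlgClosed.exists_pow_nat_eq z (n := 2) (by norm_num)
  rw [map_pow]
  exact kap_sq hκ (by simpa using hz)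

theorem kap_smul {κ : Γ} (hκ : T.proj κ = 1) (γ : Γ) {k : K} (hk : k ≠ 0) :
    T.kap (γ * κ * γ⁻¹) (T.proj γ • k) = T.kap κ k := by
  refine kap_eq (by simp [hκ]) ((smul_ne_zero_iff_ne _).mpr hk) (w := γ • T.sqrt k) ?_ ?_
  · rw [← smul_pow', sqrt_sq, smul_emb]
  · rw [mul_smul, mul_smul, inv_smul_smul, kap_spec hκ (sqrt_sq T k), smul_mul', smul_sgn]

theorem kap_prod {κ : Γ} (hκ : T.proj κ = 1) {ι : Type*} (s : Finset ι) (f : ι → K)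
    (hf : ∀ i ∈ s, f i ≠ 0) : T.kap κ (∏ i ∈ s, f i) = ∑ i ∈ s, T.kap κ (f i) := by
  classical
  induction s using Finset.induction_on with
  | empty => simpa using kap_one hκ
  | insert i s hi ih =>
    rw [Finset.prod_insert hi, Finset.sum_insert hi, kap_mul hκ (hf i (by simp))
      (Finset.prod_ne_zero_iff.mpr fun j hj => hf j (by simp [hj])),
      ih fun j hj => hf j (by simp [hj])]

variable (T) in
/-- Equality up to a nonzero constant. -/
def CE (u v : K) : Prop := ∃ z : ℂ, z ≠ 0 ∧ v = T.const z * u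

theorem CE.refl (u : K) : T.CE u u := ⟨1, one_ne_zero, by simp⟩

theorem CE.symm {u v : K} (h : T.CE u v) : T.CE v u := by
  obtain ⟨z, hz, rfl⟩ := h
  refine ⟨z⁻¹, inv_ne_zero hz, ?_⟩
  rw [← mul_assoc, ← map_mul, inv_mul_cancel₀ hz, map_one, one_mul]

theorem CE.trans {u v w : K} (h : T.CE u v) (h' : T.CE v w) : T.CE u w := by
  obtain ⟨z, hz, rfl⟩ := h
  obtain ⟨y, hy, rfl⟩ := h'
  exact ⟨y * z, mul_ne_zero hy hz, by rw [map_mul, mul_assoc]⟩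

theorem _root_.Grp.conj_ne_zero (g : Grp) {z : ℂ} (hz : z ≠ 0) : g.conj z ≠ 0 := by
  unfold Grp.conj; split_ifs <;> simpa using hz

theorem CE.smul {u v : K} (h : T.CE u v) (g : Grp) : T.CE (g • u) (g • v) := by
  obtain ⟨z, hz, rfl⟩ := h
  exact ⟨g.conj z, g.conj_ne_zero hz, by rw [smul_mul', smul_const]⟩

theorem kap_CE {κ : Γ} (hκ : T.proj κ = 1) {u v : K} (hu : u ≠ 0) (h : T.CE u v) :
    T.kap κ u = T.kap κ v := by
  obtain ⟨z, hz, rfl⟩ := h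
  rw [kap_mul hκ (by simpa using hz) hu, kap_const hκ hz, zero_add]

/-- A semi-invariant has semi-invariant square roots. -/
theorem exists_const_of_CE {u v : K} (h : T.CE u v) {w w' : Ω} (hw : w ^ 2 = T.emb u)
    (hw' : w' ^ 2 = T.emb v) : ∃ c : ℂ, c ≠ 0 ∧ w' = T.emb (T.const c) * w := by
  obtain ⟨z, hz, rfl⟩ := h
  obtain ⟨a, rfl⟩ := IsAlgClosed.exists_pow_nat_eq z (n := 2) (by norm_num)
  have : w' ^ 2 = (T.emb (T.const a) * w) ^ 2 := by rw [hw', mul_pow, hw, map_mul]; simp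
  have ha : a ≠ 0 := by rintro rfl; simp at hz
  rcases sq_eq_sq_iff_eq_or_eq_neg.mp this with h | h
  · exact ⟨a, ha, h⟩
  · exact ⟨-a, neg_ne_zero.mpr ha, by simpa using h⟩

theorem smul_sq {γ : Γ} {u : K} {w : Ω} (hw : w ^ 2 = T.emb u) :
    (γ • w) ^ 2 = T.emb (T.proj γ • u) := by
  rw [← smul_pow', hw, smul_emb]

theorem smul_emb_const (γ : Γ) (z : ℂ) :
    γ • T.emb (T.const z) = T.emb (T.const ((T.proj γ).conj z)) := by
  rw [smul_emb, smul_const]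

end Tower

namespace Grp
theorem conj_x (z : ℂ) : x.conj z = starRingEnd ℂ z := if_neg (by decide)
theorem conj_of_u1 {g : Grp} (h : g.u1 = 0) (z : ℂ) : g.conj z = z := if_pos h
theorem central_mul {z : Grp} (h1 : z.u1 = 0) (h2 : z.u2 = 0) (g : Grp) : z * g = g * z := by
  ext <;> simp only [mul_def, h1, h2] <;> ring
end Grp

namespace Tower
open Grp
variable {K Ω Γ : Type*} [Field K] [Field Ω] [Group Γ] [MulSemiringAction Grp K]
    [MulSemiringAction Γ Ω] {T : Tower K Ω Γ}

variable (T) in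
def ZSemi (u : K) : Prop := ∀ z : Grp, z.u1 = 0 → z.u2 = 0 → T.CE u (z • u)

theorem ZSemi.smul {u : K} (h : T.ZSemi u) (g : Grp) : T.ZSemi (g • u) := fun z h1 h2 => by
  rw [← mul_smul, central_mul h1 h2, mul_smul]
  exact (h z h1 h2).smul g

variable (T) in
/-- A constant as a scalar in `Ω` -/
def sc : ℂ →+* Ω := T.emb.comp T.const

theorem smul_sc (γ : Γ) (z : ℂ) : γ • T.sc z = T.sc ((T.proj γ).conj z) := smul_emb_const γ z

theorem exists_smul_eq {γ : Γ} {u : K} (h : T.CE u (T.proj γ • u)) {w : Ω}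
    (hw : w ^ 2 = T.emb u) : ∃ c : ℂ, c ≠ 0 ∧ γ • w = T.sc c * w :=
  exists_const_of_CE h hw (smul_sq hw)

theorem inv_smul_eq {γ : Γ} (hγ : (T.proj γ).u1 = 0) {w : Ω} {c : ℂ} (hc : c ≠ 0)
    (h : γ • w = T.sc c * w) : γ⁻¹ • w = T.sc c⁻¹ * w := by
  rw [inv_smul_eq_iff, smul_mul', smul_sc, conj_of_u1 hγ, h, ← mul_assoc, ← map_mul,
    inv_mul_cancel₀ hc, map_one, one_mul]

theorem kap_eq_sc {κ : Γ} (hκ : T.proj κ = 1) {u : K} (hu : u ≠ 0) {w : Ω}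
    (hw : w ^ 2 = T.emb u) {c : ℂ} (h : κ • w = T.sc c * w) : c = sgn ℂ (T.kap κ u) := by
  rw [kap_spec hκ hw, ← map_sgn T.sc] at h
  exact (T.sc.injective (mul_right_cancel₀ (ne_zero_of_sq hu hw) h)).symm

theorem sgn_pos {a : ZMod 2} {r : ℝ} (hr : 0 < r) (h : (r : ℂ) = sgn ℂ a) : a = 0 := by
  rcases zmod2_cases a with rfl | rfl
  · rfl
  · rw [sgn_one] at h
    have : r = -1 := by exact_mod_cast h
    linarith

theorem mul_conj_pos {c : ℂ} (hc : c ≠ 0) :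
    ∃ r : ℝ, 0 < r ∧ starRingEnd ℂ c * c = r :=
  ⟨Complex.normSq c, Complex.normSq_pos.mpr hc, (Complex.normSq_eq_conj_mul_self).symm⟩

section
variable {σ τ : Γ} (hσ : T.proj σ = x) (hτ : T.proj τ = y)
include hσ

theorem smul_smul_eq {u : K} (h : T.CE u (x • u)) {w : Ω} (hw : w ^ 2 = T.emb u) :
    ∃ r : ℝ, 0 < r ∧ (σ * σ) • w = T.sc r * w := by
  obtain ⟨c, hc, e⟩ := exists_smul_eq (γ := σ) (hσ ▸ h) hw
  obtain ⟨r, hr, hcr⟩ := mul_conj_pos hc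
  refine ⟨r, hr, ?_⟩
  rw [mul_smul, e, smul_mul', smul_sc, e, hσ, conj_x, ← mul_assoc, ← map_mul, hcr]

theorem u1_xx : (T.proj (σ * σ)).u1 = 0 := by rw [map_mul, hσ]; rfl

theorem proj_r1 : T.proj (σ * σ * σ * σ) = 1 := by
  simp only [map_mul, hσ]; decide

theorem kap_r1_of_x {u : K} (hu : u ≠ 0) (h : T.CE u (x • u)) :
    T.kap (σ * σ * σ * σ) u = 0 := by
  have hw := sqrt_sq T u
  obtain ⟨r, hr, e⟩ := smul_smul_eq hσ h hw
  refine sgn_pos (mul_pos hr hr) (kap_eq_sc (proj_r1 hσ) hu hw ?_).symm.symm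
  rw [mul_assoc (σ * σ), mul_smul, e, smul_mul', smul_sc, e, conj_of_u1 (u1_xx hσ), ← mul_assoc,
    ← map_mul]
  simp

theorem kap_r1_smul_x {u : K} (hu : u ≠ 0) :
    T.kap (σ * σ * σ * σ) (x • u) = T.kap (σ * σ * σ * σ) u := by
  rw [← kap_smul (proj_r1 hσ) σ hu, hσ]
  congr 1; group

include hτ
theorem proj_r4 : T.proj (σ * σ * τ * (σ * σ)⁻¹ * τ⁻¹) = 1 := by
  simp only [map_mul, map_inv, hσ, hτ]; decide

theorem proj_r5 : T.proj (σ * (τ * τ) * σ⁻¹ * (τ * τ)⁻¹) = 1 := by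
  simp only [map_mul, map_inv, hσ, hτ]; decide

omit hσ in
theorem u1_y : (T.proj τ).u1 = 0 := by rw [hτ]; rfl

/-- Computing `r4` from eigenvalues of `σ²` on `w` and `τ⁻¹ w`. -/
theorem r4_smul {w : Ω} {a b : ℂ} (hb : b ≠ 0) (h1 : (σ * σ) • w = T.sc a * w)
    (h2 : (σ * σ) • (τ⁻¹ • w) = T.sc b * (τ⁻¹ • w)) :
    (σ * σ * τ * (σ * σ)⁻¹ * τ⁻¹) • w = T.sc (b⁻¹ * a) * w := by
  rw [mul_smul, mul_smul, inv_smul_eq (u1_xx hσ) hb h2, mul_smul, smul_mul', smul_inv_smul,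
    smul_sc, conj_of_u1 (u1_y hτ), smul_mul', smul_sc, conj_of_u1 (u1_xx hσ), h1, map_mul,
    mul_assoc]

theorem kap_r4_of_x {u : K} (hu : u ≠ 0) (h : T.CE u (x • u)) (hZ : T.ZSemi u) :
    T.kap (σ * σ * τ * (σ * σ)⁻¹ * τ⁻¹) u = 0 := by
  have hw := sqrt_sq T u
  have hw' := smul_sq (γ := τ⁻¹) hw
  rw [map_inv, hτ] at hw'
  have h' : T.CE (y⁻¹ • u) (x • y⁻¹ • u) := by
    have e : x * y⁻¹ = y⁻¹ * (x * (x⁻¹ * y * x * y⁻¹)) := by decide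
    rw [← mul_smul, e, mul_smul]
    refine CE.smul ?_ _
    rw [mul_smul]
    exact h.trans ((hZ (x⁻¹ * y * x * y⁻¹) (by decide) (by decide)).smul _)
  obtain ⟨r, hr, e⟩ := smul_smul_eq hσ h hw
  obtain ⟨r', hr', e'⟩ := smul_smul_eq hσ h' hw'
  refine sgn_pos (mul_pos (inv_pos.mpr hr') hr) (kap_eq_sc (proj_r4 hσ hτ) hu hw ?_)
  rw [r4_smul hσ hτ (by exact_mod_cast hr'.ne') e e']
  simp

theorem kap_r4_of_y {u : K} (hu : u ≠ 0) (h : T.CE u (y • u)) (hZ : T.ZSemi u) :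
    T.kap (σ * σ * τ * (σ * σ)⁻¹ * τ⁻¹) u = 0 := by
  have hw := sqrt_sq T u
  obtain ⟨a, ha, e⟩ := exists_smul_eq (γ := σ * σ)
    (by rw [map_mul, hσ]; exact hZ _ (by decide) (by decide)) hw
  obtain ⟨b, hb, e'⟩ := exists_smul_eq (γ := τ) (hτ ▸ h) hw
  have e'' := inv_smul_eq (u1_y hτ) hb e'
  have := kap_eq_sc (proj_r4 hσ hτ) hu hw (r4_smul hσ hτ ha e (by
    rw [e'', smul_mul', smul_sc, conj_of_u1 (u1_xx hσ), e]; ring))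
  rw [inv_mul_cancel₀ ha] at this
  exact sgn_pos one_pos (by exact_mod_cast this)

theorem kap_r1_eq_r4 {u : K} (hu : u ≠ 0) (h : T.CE u ((x * y) • u)) (hZ : T.ZSemi u) :
    T.kap (σ * σ * σ * σ) u = T.kap (σ * σ * τ * (σ * σ)⁻¹ * τ⁻¹) u := by
  have hw := sqrt_sq T u
  obtain ⟨a, ha, e⟩ := exists_smul_eq (γ := σ * σ)
    (by rw [map_mul, hσ]; exact hZ _ (by decide) (by decide)) hw
  have hxy : T.CE (x • u) (y⁻¹ • u) := by
    have h1 := h.smul x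
    rw [← mul_smul] at h1
    refine h1.trans (CE.symm ?_)
    have e : x * (x * y) = y⁻¹ * (y * x * x * y) := by decide
    rw [e, mul_smul]
    exact (hZ _ (by decide) (by decide)).smul _
  obtain ⟨d, hd, e'⟩ := exists_const_of_CE (w := σ • T.sqrt u) (w' := τ⁻¹ • T.sqrt u) hxy
    (by rw [smul_sq hw, hσ]) (by rw [smul_sq hw, map_inv, hτ])
  have hca : starRingEnd ℂ a ≠ 0 := by simpa using ha
  have r1 := kap_eq_sc (proj_r1 hσ) hu hw (c := a * a) (by
    rw [mul_assoc (σ * σ), mul_smul, e, smul_mul', smul_sc, conj_of_u1 (u1_xx hσ), e, map_mul]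
    ring)
  have r4 := kap_eq_sc (proj_r4 hσ hτ) hu hw (r4_smul hσ hτ hca e (by
    have : (σ * σ) • σ • T.sqrt u = T.sc (starRingEnd ℂ a) * σ • T.sqrt u := by
      rw [← mul_smul, mul_assoc, mul_smul, e, smul_mul', smul_sc, hσ, conj_x]
    rw [e', smul_mul']
    change _ • T.sc d * _ = _ * (T.sc d * _)
    rw [this, smul_sc, conj_of_u1 (u1_xx hσ)]; ring))
  obtain ⟨r, hr, e4⟩ := mul_conj_pos ha
  have r4' : a = starRingEnd ℂ a * sgn ℂ (T.kap (σ * σ * τ * (σ * σ)⁻¹ * τ⁻¹) u) := by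
    rw [← r4, mul_inv_cancel_left₀ hca]
  have := sgn_pos (a := T.kap (σ * σ * σ * σ) u + T.kap (σ * σ * τ * (σ * σ)⁻¹ * τ⁻¹) u) hr (by
    rw [sgn_add, ← r1, ← e4]
    linear_combination (-(a * sgn ℂ (T.kap (σ * σ * τ * (σ * σ)⁻¹ * τ⁻¹) u))) * r4' -
      (starRingEnd ℂ a * a) * sgn_mul_self (Ω := ℂ) (T.kap (σ * σ * τ * (σ * σ)⁻¹ * τ⁻¹) u))
  exact CharTwo.add_eq_zero.mp this

end
end Tower

namespace Tower
open Grp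
variable {K Ω Γ : Type*} [Field K] [Field Ω] [Group Γ] [MulSemiringAction Grp K]
    [MulSemiringAction Γ Ω] {T : Tower K Ω Γ}

theorem exists_eigen {h : Grp} (h1 : h.u1 = 0) {v : K} (hv : v ≠ 0) {α : ℂ} (hα : α ≠ 0)
    (hh : (h * h) • v = T.const (α * α) * v) :
    ∃ v' : K, v' ≠ 0 ∧ T.CE v' (h • v') ∧ ∀ (g : Grp) (χ : ℂ), g * h = h * g →
      g.conj α⁻¹ = α⁻¹ → g • v = T.const χ * v → g • v' = T.const χ * v' := by
  by_cases h0 : v + T.const α⁻¹ * h • v = 0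
  · refine ⟨v, hv, ⟨-α, neg_ne_zero.mpr hα, ?_⟩, fun g χ _ _ h => h⟩
    have : T.const α * (v + T.const α⁻¹ * h • v) = 0 := by rw [h0, mul_zero]
    rw [mul_add, ← mul_assoc, ← map_mul, mul_inv_cancel₀ hα, map_one, one_mul] at this
    rw [map_neg]; linear_combination this
  · refine ⟨_, h0, ⟨α, hα, ?_⟩, fun g χ hg hgα e => ?_⟩
    · rw [smul_add, smul_mul', T.smul_const, conj_of_u1 h1, ← mul_smul, hh, mul_add,
        ← mul_assoc, ← mul_assoc, ← map_mul, ← map_mul, inv_mul_cancel_left₀ hα,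
        mul_inv_cancel₀ hα, map_one]
      ring
    · rw [smul_add, smul_mul', T.smul_const, hgα, e, ← mul_smul, hg, mul_smul, e, smul_mul',
        T.smul_const, conj_of_u1 h1]
      ring

theorem CE.mul_smul {u : K} {g h : Grp} (hg : T.CE u (g • u)) (hh : T.CE u (h • u)) :
    T.CE u ((g * h) • u) := by
  rw [SemigroupAction.mul_smul]; exact hg.trans (hh.smul g)

theorem center_cases : ∀ z : Grp, z.u1 = 0 → z.u2 = 0 →
    z = 1 ∨ z = x * x ∨ z = y * y ∨ z = J ∨ z = x * x * (y * y) ∨ z = x * x * J ∨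
      z = y * y * J ∨ z = x * x * (y * y) * J := by decide

theorem exists_zSemi {v : K} (hv : v ≠ 0) :
    ∃ u : K, u ≠ 0 ∧ T.ZSemi u ∧ ∀ (g : Grp) (χ : ℂ), g • v = T.const χ * v →
      g • u = T.const χ * u := by
  have step : ∀ (z : Grp) (v : K), v ≠ 0 → z.u1 = 0 → z.u2 = 0 → ∃ v' : K, v' ≠ 0 ∧
      T.CE v' (z • v') ∧ ∀ (g : Grp) (χ : ℂ), g • v = T.const χ * v → g • v' = T.const χ * v' := by
    intro z v hv h1 h2
    have hzz : z * z = 1 := by revert z; decide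
    obtain ⟨v', hv', hz, h⟩ := exists_eigen (T := T) h1 hv one_ne_zero (by simp [hzz])
    exact ⟨v', hv', hz, fun g χ => h g χ (central_mul h1 h2 g).symm (by simp [Grp.conj])⟩
  obtain ⟨v1, hv1, e1, k1⟩ := step (x * x) v hv (by decide) (by decide)
  obtain ⟨v2, hv2, e2, k2⟩ := step (y * y) v1 hv1 (by decide) (by decide)
  obtain ⟨v3, hv3, e3, k3⟩ := step J v2 hv2 (by decide) (by decide)
  have f1 : T.CE v3 ((x * x) • v3) := by
    obtain ⟨z, hz, e⟩ := e1
    exact ⟨z, hz, k3 _ _ (k2 _ _ e)⟩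
  have f2 : T.CE v3 ((y * y) • v3) := by
    obtain ⟨z, hz, e⟩ := e2
    exact ⟨z, hz, k3 _ _ e⟩
  refine ⟨v3, hv3, fun z h1 h2 => ?_, fun g χ e => k3 _ _ (k2 _ _ (k1 _ _ e))⟩
  rcases center_cases z h1 h2 with rfl | rfl | rfl | rfl | rfl | rfl | rfl | rfl
  · rw [one_smul]; exact CE.refl _
  · exact f1
  · exact f2
  · exact e3
  · exact f1.mul_smul f2
  · exact f1.mul_smul e3
  · exact f2.mul_smul e3
  · exact (f1.mul_smul f2).mul_smul e3

theorem exists_semiInvariant (S : Subgroup Grp) {v : K} (hv : v ≠ 0) :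
    ∃ u : K, u ≠ 0 ∧ T.ZSemi u ∧ (∀ g ∈ S, ∀ χ : ℂ, g • v = T.const χ * v →
      g • u = T.const χ * u) ∧ ((∀ g ∈ S, g.u1 = 0) → T.CE u (y • u)) := by
  obtain ⟨u, hu, hZ, h⟩ := exists_zSemi (T := T) hv
  by_cases hS : ∀ g ∈ S, g.u1 = 0
  · obtain ⟨ε, hε, e⟩ := hZ (y * y) (by decide) (by decide)
    obtain ⟨α, rfl⟩ := IsAlgClosed.exists_pow_nat_eq ε (n := 2) (by norm_num)
    obtain ⟨u', hu', hy, h'⟩ := exists_eigen (T := T) (h := y) (by decide) hu (α := α)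
      (by rintro rfl; simp at hε) (by rw [e, pow_two])
    have comm : ∀ g : Grp, g.u1 = 0 → g * y = y * g := by decide
    have key : ∀ (g : Grp) (χ : ℂ), g.u1 = 0 → g • u = T.const χ * u → g • u' = T.const χ * u' :=
      fun g χ hg => h' g χ (comm g hg) (conj_of_u1 hg _)
    refine ⟨u', hu', fun z h1 h2 => ?_, fun g hg χ e => key g χ (hS g hg) (h g χ e), fun _ => hy⟩
    obtain ⟨c, hc, e⟩ := hZ z h1 h2
    exact ⟨c, hc, key z c h1 e⟩
  · exact ⟨u, hu, hZ, fun g _ => h g, fun h => absurd h hS⟩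

section orbit
variable {A : Type*} [MulAction Grp A]

/-- Chosen representative of the orbit -/
noncomputable def rep (b : A) : A := (Quotient.mk (MulAction.orbitRel Grp A) b).out

theorem rep_smul (g : Grp) (b : A) : rep (g • b) = rep b := by
  unfold rep
  rw [Quotient.sound (s := MulAction.orbitRel Grp A) (a := g • b) (b := b) ⟨g, rfl⟩]

theorem exists_smul_rep (b : A) : ∃ g : Grp, g • rep b = b := by
  have h := Quotient.exact (s := MulAction.orbitRel Grp A)
    (Quotient.out_eq (Quotient.mk (MulAction.orbitRel Grp A) b))
  obtain ⟨g, hg⟩ := (MulAction.orbitRel Grp A).symm h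
  exact ⟨g, hg⟩

noncomputable def toRep (b : A) : Grp := (exists_smul_rep b).choose
theorem toRep_smul (b : A) : toRep b • rep b = b := (exists_smul_rep b).choose_spec

theorem toRep_stab (g : Grp) (b : A) :
    (toRep (g • b))⁻¹ * g * toRep b ∈ MulAction.stabilizer Grp (rep b) := by
  rw [MulAction.mem_stabilizer_iff, mul_smul, mul_smul, toRep_smul, inv_smul_eq_iff]
  conv_rhs => rw [← rep_smul g b, toRep_smul]

theorem exists_decomposition (F : A → K) (hF : ∀ a, F a ≠ 0)
    (hFg : ∀ (g : Grp) a, T.CE (F (g • a)) (g • F a)) :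
    ∃ E U : A → K, (∀ a, E a ≠ 0) ∧ (∀ a, U a ≠ 0) ∧ (∀ (g : Grp) a, g • E a = E (g • a)) ∧
      (∀ a, T.CE (E a * U a) (F a)) ∧ (∀ a, T.ZSemi (U a)) ∧
      (∀ (g : Grp) a, T.CE (U (g • a)) (g • U a)) ∧
      (∀ a, (∀ g : Grp, g • a = a → g.u1 = 0) → T.CE (U a) (y • U a)) := by
  choose u hu hZ hS hN using fun a : A =>
    exists_semiInvariant (T := T) (MulAction.stabilizer Grp a) (hF a)
  have hst : ∀ a, ∀ s ∈ MulAction.stabilizer Grp a, ∃ χ : ℂ, χ ≠ 0 ∧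
      s • F a = T.const χ * F a ∧ s • u a = T.const χ * u a := by
    intro a s hs
    obtain ⟨χ, hχ, e⟩ := hFg s a
    rw [hs] at e
    exact ⟨χ, hχ, e, hS a s hs χ e⟩
  have split : ∀ (g : Grp) (a : A), g * toRep a =
      toRep (g • a) * ((toRep (g • a))⁻¹ * g * toRep a) := fun g a => by group
  refine ⟨fun a => toRep a • (F (rep a) / u (rep a)), fun a => toRep a • u (rep a), ?_, ?_, ?_,
    ?_, ?_, ?_, ?_⟩
  · exact fun a => (smul_ne_zero_iff_ne _).mpr (div_ne_zero (hF _) (hu _))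
  · exact fun a => (smul_ne_zero_iff_ne _).mpr (hu _)
  · intro g a
    obtain ⟨χ, hχ, e, e'⟩ := hst _ _ (toRep_stab g a)
    have hχ' : T.const χ ≠ 0 := by simpa using hχ
    beta_reduce
    rw [← mul_smul, split, mul_smul, rep_smul, smul_div₀', e, e', mul_div_mul_left _ _ hχ']
  · intro a
    beta_reduce
    rw [← smul_mul', div_mul_cancel₀ _ (hu _)]
    have := hFg (toRep a) (rep a)
    rw [toRep_smul] at this
    exact this.symm
  · exact fun a => (hZ _).smul _
  · intro g a
    obtain ⟨χ, hχ, e, e'⟩ := hst _ _ (toRep_stab g a)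
    beta_reduce
    rw [← mul_smul, split, mul_smul _ _ (u (rep a)), rep_smul, e']
    exact CE.smul ⟨χ, hχ, rfl⟩ _
  · intro a ha
    have key := hN (rep a) fun g hg => by
      have := ha (toRep a * g * (toRep a)⁻¹) (by
        have e : (toRep a)⁻¹ • a = rep a := by rw [inv_smul_eq_iff, toRep_smul]
        rw [mul_smul, mul_smul, e, hg, toRep_smul])
      simp only [u1_mul, u1_inv] at this
      rwa [add_right_comm, CharTwo.add_self_eq_zero, zero_add] at this
    have e : y * toRep a = toRep a * (y * (y⁻¹ * (toRep a)⁻¹ * y * toRep a)) := by group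
    beta_reduce
    rw [← mul_smul, e, mul_smul]
    refine CE.smul (key.mul_smul (hZ _ _ ?_ ?_)) _ <;> simp <;> ring_nf <;> reduce_mod_char

end orbit
end Tower

namespace Tower
open Grp
variable {K Ω Γ : Type*} [Field K] [Field Ω] [Group Γ] [MulSemiringAction Grp K]
    [MulSemiringAction Γ Ω] {T : Tower K Ω Γ}

theorem sum_smul_comp {A M : Type*} [Fintype A] [MulAction Grp A] [AddCommMonoid M] (g : Grp)
    (f : A → M) : ∑ b, f (g • b) = ∑ b, f b :=
  Equiv.sum_comp (MulAction.toPerm g) f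

theorem smul_zmod2_smul {A : Type*} [AddCommGroup A] [Module (ZMod 2) A] [DistribMulAction Grp A]
    (g : Grp) (t : ZMod 2) (b : A) : g • t • b = t • g • b := by
  rcases zmod2_cases t with rfl | rfl <;> simp

section
variable {A : Type*} [Fintype A] [AddCommGroup A] [Module (ZMod 2) A] [DistribMulAction Grp A]

variable (T) in
/-- Additive character built from a family of Kummer symbols -/
noncomputable def kapSum (κ : Γ) (F : A → K) : A := ∑ a, T.kap κ (F a) • a

theorem exists_crossed (E : A → K) (hE : ∀ a, E a ≠ 0)
    (hEg : ∀ (g : Grp) a, g • E a = E (g • a)) :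
    ∃ C : Γ → A, (∀ γ δ, C (γ * δ) = C γ + T.proj γ • C δ) ∧
      ∀ κ, T.proj κ = 1 → T.kapSum κ E = C κ := by
  have := T.charZero
  have hs : ∀ (γ : Γ) (b : A), ∃ a, γ • T.sqrt (E b) = sgn Ω a * T.sqrt (E (T.proj γ • b)) := by
    intro γ b
    apply exists_sgn
    rw [smul_sq (sqrt_sq T _), sqrt_sq, hEg]
  choose h hh using hs
  have hmul : ∀ γ δ b, h (γ * δ) b = h δ b + h γ (T.proj δ • b) := by
    intro γ δ b
    have e := hh (γ * δ) b
    rw [mul_smul, hh δ, smul_mul', smul_sgn, hh γ, ← mul_assoc, ← sgn_add, map_mul,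
      mul_smul] at e
    exact (sgn_injective (mul_right_cancel₀ (ne_zero_of_sq (hE _) (sqrt_sq T _)) e)).symm
  refine ⟨fun γ => ∑ b, h γ b • T.proj γ • b, fun γ δ => ?_, fun κ hκ => ?_⟩
  · simp only [hmul, add_smul, Finset.sum_add_distrib, Finset.smul_sum, smul_zmod2_smul, map_mul,
      mul_smul]
    rw [add_comm, sum_smul_comp (T.proj δ) (fun b => h γ b • T.proj γ • b)]
  · refine Finset.sum_congr rfl fun b _ => ?_
    have := hh κ b
    rw [hκ, one_smul] at this
    rw [hκ, one_smul, kap_eq hκ (hE b) (sqrt_sq T _) this]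

end

variable {σ τ : Γ} (hσ : T.proj σ = x) (hτ : T.proj τ = y)
include hσ hτ

theorem crossed_relation (C : Γ → Mat5) (hC : ∀ γ δ, C (γ * δ) = C γ + T.proj γ • C δ) :
    C (σ * σ * σ * σ) 0 3 + C (σ * σ * τ * (σ * σ)⁻¹ * τ⁻¹) 1 2 +
      C (σ * (τ * τ) * σ⁻¹ * (τ * τ)⁻¹) 3 4 = 0 := by
  have k4 : C (σ * σ * τ * (σ * σ)⁻¹ * τ⁻¹ * (τ * (σ * σ))) = C (σ * σ * τ) :=
    congrArg C (by group)
  have k5 : C (σ * (τ * τ) * σ⁻¹ * (τ * τ)⁻¹ * (τ * τ * σ)) = C (σ * (τ * τ)) :=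
    congrArg C (by group)
  rw [hC, proj_r4 hσ hτ, one_smul, hC τ, hC (σ * σ), hC σ σ, map_mul, hσ, hτ] at k4
  rw [hC, proj_r5 hσ hτ, one_smul, hC (τ * τ), hC σ (τ * τ), hC τ τ, map_mul, hσ, hτ] at k5
  have L := linear_relation (C σ) (C τ)
  rw [← k4, ← k5] at L
  rw [hC, hC (σ * σ), hC σ]
  simp only [map_mul, hσ]
  simpa using L

theorem invariant_relation (E : Mat5 → K) (hE : ∀ a, E a ≠ 0)
    (hEg : ∀ (g : Grp) a, g • E a = E (g • a)) :
    T.kapSum (σ * σ * σ * σ) E 0 3 + T.kapSum (σ * σ * τ * (σ * σ)⁻¹ * τ⁻¹) E 1 2 +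
      T.kapSum (σ * (τ * τ) * σ⁻¹ * (τ * τ)⁻¹) E 3 4 = 0 := by
  obtain ⟨C, hC, hker⟩ := exists_crossed (T := T) E hE hEg
  rw [hker _ (proj_r1 hσ), hker _ (proj_r4 hσ hτ), hker _ (proj_r5 hσ hτ)]
  exact crossed_relation hσ hτ C hC
end Tower

namespace Tower
open Grp
variable {K Ω Γ : Type*} [Field K] [Field Ω] [Group Γ] [MulSemiringAction Grp K]
    [MulSemiringAction Γ Ω] {T : Tower K Ω Γ}
variable {A : Type*} [Fintype A] [AddCommGroup A] [DistribMulAction Grp A]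

theorem exists_half (W : Finset A) (hW : ∀ (g : Grp), ∀ b ∈ W, g • b ∈ W)
    (L : Grp → ZMod 2) (hL : ∀ g h, L (g * h) = L g + L h)
    (hs : ∀ b ∈ W, ∀ s : Grp, s • b = b → L s = 0) :
    ∃ b : A, (∀ g, L g = 0 → g • b = b) ∧ ∀ g, L g = 1 → ∑ a ∈ W, a = b + g • b := by
  classical
  have hψ : ∀ b ∈ W, ∀ g : Grp, L (toRep (g • b)) = L g + L (toRep b) := by
    intro b hb g
    have e : g * toRep b = toRep (g • b) * ((toRep (g • b))⁻¹ * g * toRep b) := by group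
    have hrep : rep b ∈ W := by
      have : (toRep b)⁻¹ • b = rep b := by rw [inv_smul_eq_iff, toRep_smul]
      exact this ▸ hW _ b hb
    rw [← hL, e, hL, hs _ hrep _ (toRep_stab g b), add_zero]
  have hW' : ∀ (g : Grp) (b : A), g • b ∈ W ↔ b ∈ W :=
    fun g b => ⟨fun h => by simpa using hW g⁻¹ _ h, hW g b⟩
  have hg : ∀ g : Grp, g • (∑ b, if b ∈ W ∧ L (toRep b) = 0 then b else 0) =
      ∑ b, if b ∈ W ∧ L (toRep b) = L g then b else 0 := by
    intro g
    rw [← sum_smul_comp g (fun b => if b ∈ W ∧ L (toRep b) = L g then b else 0),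
      Finset.smul_sum]
    refine Finset.sum_congr rfl fun b _ => ?_
    simp only [hW']
    by_cases hb : b ∈ W
    · rw [hψ b hb g]
      by_cases h0 : L (toRep b) = 0 <;> simp [hb, h0]
    · simp [hb]
  refine ⟨∑ b, if b ∈ W ∧ L (toRep b) = 0 then b else 0, fun g h => ?_, fun g h => ?_⟩
  · rw [hg, h]
  · rw [hg, h, ← Finset.sum_add_distrib, ← Finset.sum_filter_add_sum_filter_not Finset.univ (· ∈ W)]
    rw [Finset.sum_eq_zero (s := Finset.univ.filter (· ∉ W)), add_zero]
    · rw [Finset.filter_univ_mem]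
      refine Finset.sum_congr rfl fun b hb => ?_
      rcases zmod2_cases (L (toRep b)) with h | h <;> simp [hb, h]
    · intro b hb
      simp at hb
      simp [hb]

theorem u_cases : ∀ g : Grp, ∃ z : Grp, z.u1 = 0 ∧ z.u2 = 0 ∧
    (g = z ∨ g = x * z ∨ g = y * z ∨ g = x * y * z) := by decide

variable {σ τ : Γ} (hσ : T.proj σ = x) (hτ : T.proj τ = y)

include hσ in
theorem kap_r1_smul {u : K} (hu : u ≠ 0) (hZ : T.ZSemi u)
    (h : T.CE u (y • u) ∨ T.CE u ((x * y) • u)) (g : Grp) :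
    T.kap (σ * σ * σ * σ) (g • u) = T.kap (σ * σ * σ * σ) u := by
  have ne : ∀ g : Grp, g • u ≠ 0 := fun g => (smul_ne_zero_iff_ne _).mpr hu
  have hy : T.kap (σ * σ * σ * σ) (y • u) = T.kap (σ * σ * σ * σ) u := by
    rcases h with h | h
    · exact (kap_CE (proj_r1 hσ) hu h).symm
    · rw [kap_CE (proj_r1 hσ) hu h, mul_smul, kap_r1_smul_x hσ (ne _)]
  obtain ⟨z, h1, h2, rfl | rfl | rfl | rfl⟩ := u_cases g
  · exact (kap_CE (proj_r1 hσ) hu (hZ g h1 h2)).symm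
  · rw [mul_smul, kap_r1_smul_x hσ (ne _), kap_CE (proj_r1 hσ) hu (hZ z h1 h2)]
  · rw [mul_smul, ← kap_CE (proj_r1 hσ) (ne _) ((hZ z h1 h2).smul y), hy]
  · rw [mul_smul, mul_smul, kap_r1_smul_x hσ ((smul_ne_zero_iff_ne _).mpr (ne _)),
      ← kap_CE (proj_r1 hσ) (ne _) ((hZ z h1 h2).smul y), hy]

theorem CE_of_mul_central {u : K} (hZ : T.ZSemi u) {s g : Grp} (h : T.CE u (s • u))
    (h1 : g.u1 = s.u1) (h2 : g.u2 = s.u2) : T.CE u (g • u) := by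
  have e : s = g * (g⁻¹ * s) := by group
  rw [e, mul_smul] at h
  refine h.trans (CE.smul (CE.symm (hZ _ ?_ ?_)) _) <;> simp [h1, h2, CharTwo.add_self_eq_zero]

include hσ hτ

theorem semiInvariant_relation (U : A → K) (hU : ∀ a, U a ≠ 0) (hZ : ∀ a, T.ZSemi (U a))
    (hg : ∀ (g : Grp) a, T.CE (U (g • a)) (g • U a))
    (hN : ∀ a, (∀ g : Grp, g • a = a → g.u1 = 0) → T.CE (U a) (y • U a))
    (l l' l'' : A →+ ZMod 2) (h5 : ∀ a, l'' ((x * x) • a) = l'' a)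
    (h5' : ∀ a, (x * x) • a = a → l'' a = 0)
    (hlN : ∀ a, (x * x) • a = a → y • a = a → J • a = a → l (a + x • a) = 0)
    (hlM : ∀ a, (x * x) • a = a → (x * y) • a = a → (y * y) • a = a → J • a = a →
      l (a + x • a) + l' (a + x • a) = 0) :
    ∑ a, (T.kap (σ * σ * σ * σ) (U a) * l a +
      T.kap (σ * σ * τ * (σ * σ)⁻¹ * τ⁻¹) (U a) * l' a +
      T.kap (σ * (τ * τ) * σ⁻¹ * (τ * τ)⁻¹) (U a) * l'' a) = 0 := by
  classical
  have p1 := proj_r1 hσ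
  have p5 := proj_r5 hσ hτ
  set r1 := σ * σ * σ * σ
  set r4 := σ * σ * τ * (σ * σ)⁻¹ * τ⁻¹
  set r5 := σ * (τ * τ) * σ⁻¹ * (τ * τ)⁻¹
  rw [Finset.sum_add_distrib]
  have s5 : ∑ a, T.kap r5 (U a) * l'' a = 0 := by
    have k : ∀ a, T.kap r5 (U ((x * x) • a)) = T.kap r5 (U a) := fun a => by
      rw [kap_CE p5 (hU _) (hg _ a)]
      exact (kap_CE p5 (hU a) (hZ a _ (by decide) (by decide))).symm
    refine Finset.sum_involution (fun a _ => (x * x) • a) ?_ ?_ (fun _ _ => Finset.mem_univ _) ?_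
    · intro a _
      rw [k, h5, CharTwo.add_self_eq_zero]
    · intro a _ ha e
      exact ha (by rw [h5' a e, mul_zero])
    · intro a _
      rw [← mul_smul, show x * x * (x * x) = 1 by decide, one_smul]
  rw [s5, add_zero]
  -- the three kinds of stabilisers
  let PN : A → Prop := fun a => ∀ s : Grp, s • a = a → s.u1 = 0
  let PM : A → Prop := fun a => (∀ s : Grp, s • a = a → s.u1 + s.u2 = 0) ∧
    ∃ s : Grp, s • a = a ∧ s.u1 = 1 ∧ s.u2 = 1
  have conj : ∀ (g s : Grp) (a : A), s • g • a = g • a → (g⁻¹ * s * g) • a = a := by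
    intro g s a h
    rw [mul_smul, mul_smul, h, inv_smul_smul]
  have conj1 : ∀ g s : Grp, (g⁻¹ * s * g).u1 = s.u1 := by
    intro g s; simp [add_right_comm, CharTwo.add_self_eq_zero]
  have conj2 : ∀ g s : Grp, (g⁻¹ * s * g).u2 = s.u2 := by
    intro g s; simp [add_right_comm, CharTwo.add_self_eq_zero]
  have PNg : ∀ (g : Grp) a, PN a → PN (g • a) := fun g a h s hs =>
    conj1 g s ▸ h _ (conj g s a hs)
  have PMg : ∀ (g : Grp) a, PM a → PM (g • a) := by
    rintro g a ⟨h, s, hs, e1, e2⟩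
    refine ⟨fun s hs => ?_, g * s * g⁻¹, ?_, ?_, ?_⟩
    · rw [← conj1 g s, ← conj2 g s]; exact h _ (conj g s a hs)
    · rw [mul_smul, mul_smul, inv_smul_smul, hs]
    · simpa [e1] using conj1 g⁻¹ s
    · simpa [e2] using conj2 g⁻¹ s
  have CEM : ∀ a, PM a → T.CE (U a) ((x * y) • U a) := by
    rintro a ⟨-, s, hs, e1, e2⟩
    have := hg s a
    rw [hs] at this
    exact CE_of_mul_central (hZ a) this (e1 ▸ rfl) (e2 ▸ rfl)
  have CEN : ∀ a, PN a → T.CE (U a) (y • U a) := hN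
  have inv1 : ∀ a, PM a ∨ PN a → ∀ g : Grp, T.kap r1 (U (g • a)) = T.kap r1 (U a) := by
    intro a ha g
    rw [kap_CE p1 (hU _) (hg g a), kap_r1_smul hσ (hU a) (hZ a) _ g]
    exact ha.elim (fun h => Or.inr (CEM a h)) (fun h => Or.inl (CEN a h))
  let WM : Finset A := Finset.univ.filter fun a => PM a ∧ T.kap r1 (U a) = 1
  let WN : Finset A := Finset.univ.filter fun a => PN a ∧ T.kap r1 (U a) = 1
  have mWM : ∀ a, a ∈ WM ↔ PM a ∧ T.kap r1 (U a) = 1 := fun a => by simp [WM]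
  have mWN : ∀ a, a ∈ WN ↔ PN a ∧ T.kap r1 (U a) = 1 := fun a => by simp [WN]
  have term : ∀ a, T.kap r1 (U a) * l a + T.kap r4 (U a) * l' a =
      (if a ∈ WM then l a + l' a else 0) + if a ∈ WN then l a else 0 := by
    intro a
    rw [if_congr (mWM a) rfl rfl, if_congr (mWN a) rfl rfl]
    by_cases hn : PN a
    · have hm : ¬ PM a := fun ⟨_, s, hs, e1, _⟩ => by
        rw [hn s hs] at e1; exact absurd e1 (by decide)
      rw [kap_r4_of_y hσ hτ (hU a) (CEN a hn) (hZ a)]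
      rcases zmod2_cases (T.kap r1 (U a)) with h | h <;> simp [hn, hm, h]
    · by_cases hm : PM a
      · rw [← kap_r1_eq_r4 hσ hτ (hU a) (CEM a hm) (hZ a)]
        rcases zmod2_cases (T.kap r1 (U a)) with h | h <;> simp [hn, hm, h, r1]
      · have hx : T.CE (U a) (x • U a) := by
          have : ∃ s : Grp, s • a = a ∧ s.u1 = 1 ∧ s.u2 = 0 := by
            by_contra hc
            push Not at hc
            simp only [PN, not_forall] at hn
            obtain ⟨s, hs, e1⟩ := hn
            have e1 := (zmod2_cases s.u1).resolve_left e1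
            have e2 := (zmod2_cases s.u2).resolve_left (hc s hs e1)
            refine hm ⟨fun t ht => ?_, s, hs, e1, e2⟩
            rcases zmod2_cases t.u1 with h1 | h1 <;> rcases zmod2_cases t.u2 with h2 | h2
            · rw [h1, h2, add_zero]
            · exact absurd (show (s * t).u2 = 0 by rw [u2_mul, e2, h2]; rfl)
                (hc (s * t) (by rw [mul_smul, ht, hs]) (by rw [u1_mul, e1, h1]; rfl))
            · exact absurd h2 (hc t ht h1)
            · rw [h1, h2]; rfl
          obtain ⟨s, hs, e1, e2⟩ := this
          have := hg s a
          rw [hs] at this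
          exact CE_of_mul_central (hZ a) this (e1 ▸ rfl) (e2 ▸ rfl)
        rw [kap_r1_of_x hσ (hU a) hx, kap_r4_of_x hσ hτ (hU a) hx (hZ a)]
        simp [hm, hn]
  rw [Finset.sum_congr rfl fun a _ => term a, Finset.sum_add_distrib, Finset.sum_ite_mem,
    Finset.sum_ite_mem, Finset.univ_inter, Finset.univ_inter, Finset.sum_add_distrib,
    ← map_sum, ← map_sum, ← map_sum]
  obtain ⟨b, hb, hb'⟩ := exists_half WM
    (fun g a ha => by
      rw [mWM] at ha ⊢
      exact ⟨PMg g a ha.1, by rw [inv1 a (Or.inl ha.1), ha.2]⟩)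
    (fun g => g.u1 + g.u2) (fun g h => by simp only [u1_mul, u2_mul]; ring)
    (fun a ha => ((mWM a).mp ha).1.1)
  obtain ⟨d, hd, hd'⟩ := exists_half WN
    (fun g a ha => by
      rw [mWN] at ha ⊢
      exact ⟨PNg g a ha.1, by rw [inv1 a (Or.inr ha.1), ha.2]⟩)
    (fun g => g.u1) (fun g h => u1_mul g h)
    (fun a ha => ((mWN a).mp ha).1)
  rw [hb' x rfl, hd' x rfl, hlM b (hb _ rfl) (hb _ rfl) (hb _ rfl) (hb _ rfl),
    hlN d (hd _ rfl) (hd _ rfl) (hd _ rfl), add_zero]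

end Tower

namespace Tower
open Grp
variable {K Ω Γ : Type*} [Field K] [Field Ω] [Group Γ] [MulSemiringAction Grp K]
    [MulSemiringAction Γ Ω] {T : Tower K Ω Γ}

section
variable {A : Type*} [Fintype A] [AddCommGroup A] [Module (ZMod 2) A]

omit [Fintype A] in
theorem map_zmod2_smul (l : A →+ ZMod 2) (t : ZMod 2) (a : A) : l (t • a) = t * l a := by
  rcases zmod2_cases t with rfl | rfl <;> simp

theorem map_kapSum (l : A →+ ZMod 2) (κ : Γ) (F : A → K) :
    l (T.kapSum κ F) = ∑ a, T.kap κ (F a) * l a := by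
  simp only [kapSum, map_sum, map_zmod2_smul]

theorem kapSum_mul {κ : Γ} (hκ : T.proj κ = 1) {E U F : A → K} (hE : ∀ a, E a ≠ 0)
    (hU : ∀ a, U a ≠ 0) (h : ∀ a, T.CE (E a * U a) (F a)) :
    T.kapSum κ F = T.kapSum κ E + T.kapSum κ U := by
  rw [kapSum, kapSum, kapSum, ← Finset.sum_add_distrib]
  refine Finset.sum_congr rfl fun a _ => ?_
  rw [← kap_CE hκ (mul_ne_zero (hE a) (hU a)) (h a), kap_mul hκ (hE a) (hU a), add_smul]

end

variable {σ τ : Γ} (hσ : T.proj σ = x) (hτ : T.proj τ = y)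
include hσ hτ

/-- The relation satisfied by the Kummer symbols of an equivariant family. -/
theorem kapSum_relation (F : Mat5 → K) (hF : ∀ a, F a ≠ 0)
    (hFg : ∀ (g : Grp) a, T.CE (F (g • a)) (g • F a)) :
    T.kapSum (σ * σ * σ * σ) F 0 3 + T.kapSum (σ * σ * τ * (σ * σ)⁻¹ * τ⁻¹) F 1 2 +
      T.kapSum (σ * (τ * τ) * σ⁻¹ * (τ * τ)⁻¹) F 3 4 = 0 := by
  obtain ⟨E, U, hE, hU, hEg, hEU, hZ, hg, hN⟩ := exists_decomposition F hF hFg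
  have e1 := invariant_relation hσ hτ E hE hEg
  let l (i j : Fin 5) : Mat5 →+ ZMod 2 := Matrix.entryAddMonoidHom (ZMod 2) i j
  have e2 := semiInvariant_relation hσ hτ U hU hZ hg hN (l 0 3) (l 1 2) (l 3 4)
    xx_smul_34 entry_34_of_fixed entry_of_fixed_N entry_of_fixed_M
  rw [Finset.sum_add_distrib, Finset.sum_add_distrib, ← map_kapSum, ← map_kapSum,
    ← map_kapSum] at e2
  rw [kapSum_mul (proj_r1 hσ) hE hU hEU, kapSum_mul (proj_r4 hσ hτ) hE hU hEU,
    kapSum_mul (proj_r5 hσ hτ) hE hU hEU, Matrix.add_apply, Matrix.add_apply, Matrix.add_apply]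
  replace e2 : T.kapSum (σ * σ * σ * σ) U 0 3 + T.kapSum (σ * σ * τ * (σ * σ)⁻¹ * τ⁻¹) U 1 2 +
      T.kapSum (σ * (τ * τ) * σ⁻¹ * (τ * τ)⁻¹) U 3 4 = 0 := e2
  linear_combination e1 + e2
end Tower

section
variable {R : Type*} [CommRing R] [IsDomain R] [UniqueFactorizationMonoid R]

open UniqueFactorizationMonoid

theorem multiplicity_mul_of_ne_zero {p a b : R} (hp : Prime p) (ha : a ≠ 0) (hb : b ≠ 0) :
    multiplicity p (a * b) = multiplicity p a + multiplicity p b :=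
  multiplicity_mul hp (FiniteMultiplicity.of_prime_left hp (mul_ne_zero ha hb))

theorem multiplicity_pow_of_ne_zero {p a : R} (hp : Prime p) (ha : a ≠ 0) (k : ℕ) :
    multiplicity p (a ^ k) = k * multiplicity p a :=
  (FiniteMultiplicity.of_prime_left hp ha).multiplicity_pow hp

theorem multiplicity_prod_of_ne_zero {ι : Type*} {p : R} (hp : Prime p) (s : Finset ι)
    (f : ι → R) (hf : ∀ i ∈ s, f i ≠ 0) :
    multiplicity p (∏ i ∈ s, f i) = ∑ i ∈ s, multiplicity p (f i) := by
  classical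
  induction s using Finset.induction_on with
  | empty => simpa using multiplicity_eq_zero.mpr fun h => hp.not_isUnit (isUnit_of_dvd_one h)
  | insert i s hi ih =>
    rw [Finset.prod_insert hi, Finset.sum_insert hi,
      multiplicity_mul_of_ne_zero hp (hf i (by simp))
        (Finset.prod_ne_zero_iff.mpr fun j hj => hf j (by simp [hj])),
      ih fun j hj => hf j (by simp [hj])]

theorem associated_of_multiplicity_eq {a b : R} (ha : a ≠ 0) (hb : b ≠ 0)
    (h : ∀ p, Prime p → multiplicity p a = multiplicity p b) : Associated a b := by
  classical
  let := UniqueFactorizationMonoid.strongNormalizationMonoid (α := R)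
  rw [associated_iff_normalizedFactors_eq_normalizedFactors ha hb]
  ext p
  by_cases hp : p ∈ normalizedFactors a ∨ p ∈ normalizedFactors b
  · have hp' : Prime p := hp.elim (prime_of_normalized_factor p) (prime_of_normalized_factor p)
    have hn : normalize p = p :=
      hp.elim (normalize_normalized_factor p) (normalize_normalized_factor p)
    have := h p hp'
    rwa [multiplicity_eq_count_normalizedFactors hp'.irreducible ha,
      multiplicity_eq_count_normalizedFactors hp'.irreducible hb, hn] at this
  · rw [not_or] at hp
    rw [Multiset.count_eq_zero_of_notMem hp.1, Multiset.count_eq_zero_of_notMem hp.2]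

theorem exists_eq_unit_mul_sq {r : R} (hr : r ≠ 0) (h : ∀ p, Prime p → Even (multiplicity p r)) :
    ∃ v s : R, IsUnit v ∧ s ≠ 0 ∧ r = v * s ^ 2 := by
  classical
  let := UniqueFactorizationMonoid.strongNormalizationMonoid (α := R)
  let s := ∏ p ∈ (normalizedFactors r).toFinset, p ^ ((normalizedFactors r).count p / 2)
  have hs : s ^ 2 = (normalizedFactors r).prod := by
    rw [Finset.prod_multiset_count, ← Finset.prod_pow]
    refine Finset.prod_congr rfl fun p hp => ?_
    rw [Multiset.mem_toFinset] at hp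
    have hp' := prime_of_normalized_factor p hp
    have := h p hp'
    rw [multiplicity_eq_count_normalizedFactors hp'.irreducible hr,
      normalize_normalized_factor p hp] at this
    rw [← pow_mul, Nat.div_mul_cancel this.two_dvd]
  obtain ⟨v, hv⟩ := prod_normalizedFactors hr
  refine ⟨v, s, v.isUnit, ?_, ?_⟩
  · intro h0
    rw [← hs, h0] at hv
    exact hr (by rw [← hv]; simp)
  · rw [hs, mul_comm, hv]

/-- A finite set of normalized primes, cut into pieces according to a label. -/
theorem exists_squarefree_family {A : Type*} (e : R → A) (he : ∀ p q, Associated p q → e p = e q)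
    (P : R) (hP : P ≠ 0) (Z : A) (hZ : ∀ p, Prime p → e p ≠ Z → p ∣ P) :
    ∃ F : A → R, (∀ a, F a ≠ 0) ∧ ∀ p, Prime p → ∀ a, a ≠ Z →
      (e p = a → multiplicity p (F a) = 1) ∧ (e p ≠ a → multiplicity p (F a) = 0) := by
  classical
  let := UniqueFactorizationMonoid.strongNormalizationMonoid (α := R)
  let S (a : A) : Finset R := (normalizedFactors P).toFinset.filter (e · = a)
  have hS : ∀ a p, p ∈ S a ↔ p ∈ normalizedFactors P ∧ e p = a := fun a p => by
    rw [Finset.mem_filter, Multiset.mem_toFinset]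
  have hF : ∀ a, (S a).val.prod ≠ 0 := fun a => by
    intro h
    rw [Multiset.prod_eq_zero_iff, Finset.mem_val, hS] at h
    exact zero_notMem_normalizedFactors _ h.1
  refine ⟨fun a => (S a).val.prod, hF, fun p hp a ha => ?_⟩
  have hn : normalizedFactors (S a).val.prod = (S a).val := by
    rw [normalizedFactors_prod_eq]
    · refine (Multiset.map_congr rfl fun q hq => ?_).trans (Multiset.map_id _)
      exact normalize_normalized_factor q ((hS a q).mp (Finset.mem_val.mp hq)).1
    · intro q hq
      exact irreducible_of_normalized_factor q ((hS a q).mp (Finset.mem_val.mp hq)).1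
  have hpn : e (normalize p) = e p := he _ _ (normalize_associated p)
  rw [multiplicity_eq_count_normalizedFactors hp.irreducible (hF a), hn]
  constructor
  · intro h
    refine Multiset.count_eq_one_of_mem (S a).nodup ?_
    rw [Finset.mem_val, hS, mem_normalizedFactors_iff' hP]
    exact ⟨⟨(normalize_associated p).irreducible_iff.mpr hp.irreducible, normalize_idem p,
      (normalize_associated p).dvd.trans (hZ p hp (h ▸ ha))⟩, hpn.trans h⟩
  · intro h
    refine Multiset.count_eq_zero_of_notMem ?_
    rw [Finset.mem_val, hS, hpn]
    exact fun h' => h h'.2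

variable [MulSemiringAction Grp R] {A : Type*} [Fintype A] [AddCommGroup A] [Module (ZMod 2) A]
  [DistribMulAction Grp A]

omit [MulSemiringAction Grp R] in
theorem parity_of_sq {p a b d n : R} (hp : Prime p) (ha : a ≠ 0) (hb : b ≠ 0) (hd : d ≠ 0)
    (hn : n ≠ 0) (h : a * d ^ 2 = b * n ^ 2) :
    (multiplicity p a : ZMod 2) = multiplicity p b := by
  have := congrArg (fun r => (multiplicity p r : ZMod 2)) h
  simp only [multiplicity_mul_of_ne_zero hp ha (pow_ne_zero 2 hd),
    multiplicity_mul_of_ne_zero hp hb (pow_ne_zero 2 hn), multiplicity_pow_of_ne_zero hp hd,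
    multiplicity_pow_of_ne_zero hp hn] at this
  push_cast at this
  simpa [show (2 : ZMod 2) = 0 from rfl] using this

theorem exists_equivariant_family (f : Module.Dual (ZMod 2) A → R) (hf : ∀ l, f l ≠ 0)
    (hadd : ∀ l m, ∃ d n, d ≠ 0 ∧ n ≠ 0 ∧ f (l + m) * d ^ 2 = f l * f m * n ^ 2)
    (hsmul : ∀ (g : Grp) l m, (∀ a, m a = l (g⁻¹ • a)) →
      ∃ d n, d ≠ 0 ∧ n ≠ 0 ∧ (g • f l) * d ^ 2 = f m * n ^ 2) :
    ∃ F : A → R, (∀ a, F a ≠ 0) ∧ (∀ (g : Grp) a, Associated (g • F a) (F (g • a))) ∧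
      ∀ l, ∃ v s, IsUnit v ∧ s ≠ 0 ∧ f l * ∏ a, F a ^ (l a).val = v * s ^ 2 := by
  classical
  have hex : ∀ p : R, ∃ a : A, Prime p → ∀ l : Module.Dual (ZMod 2) A,
      l a = (multiplicity p (f l) : ZMod 2) := by
    intro p
    by_cases hp : Prime p
    · let φ : Module.Dual (ZMod 2) A →+ ZMod 2 := AddMonoidHom.mk'
        (fun l => (multiplicity p (f l) : ZMod 2)) (fun l m => by
          obtain ⟨d, n, hd, hn, h⟩ := hadd l m
          rw [parity_of_sq hp (hf _) (mul_ne_zero (hf l) (hf m)) hd hn h,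
            multiplicity_mul_of_ne_zero hp (hf l) (hf m), Nat.cast_add])
      refine ⟨(Module.evalEquiv (ZMod 2) A).symm (AddMonoidHom.toZModLinearMap 2 φ),
        fun _ l => ?_⟩
      rw [Module.apply_evalEquiv_symm_apply]
      rfl
    · exact ⟨0, fun h => absurd h hp⟩
  choose e' he' using hex
  let e : R → A := fun p => if Prime p then e' p else 0
  have he : ∀ p, Prime p → ∀ l : Module.Dual (ZMod 2) A,
      l (e p) = (multiplicity p (f l) : ZMod 2) := fun p hp l => by
    simp only [e, if_pos hp, he' p hp]
  have hsep : ∀ a b : A, (∀ l : Module.Dual (ZMod 2) A, l a = l b) → a = b := fun a b h =>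
    (Module.evalEquiv (ZMod 2) A).injective (by ext l; exact h l)
  obtain ⟨F, hF, hFm⟩ := exists_squarefree_family e (fun p q hpq => by
    by_cases hp : Prime p
    · refine hsep _ _ fun l => ?_
      rw [he p hp, he q (hpq.prime hp), multiplicity_eq_of_associated_left hpq]
    · have hq : ¬ Prime q := fun hq => hp (hpq.symm.prime hq)
      simp only [e, if_neg hp, if_neg hq]) (∏ᶠ l, f l) (by
        have : Finite (Module.Dual (ZMod 2) A) := Module.finite_of_finite (ZMod 2)
        have := Fintype.ofFinite (Module.Dual (ZMod 2) A)
        rw [finprod_eq_prod_of_fintype]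
        exact Finset.prod_ne_zero_iff.mpr fun l _ => hf l) 0 (fun p hp h => by
        have : Finite (Module.Dual (ZMod 2) A) := Module.finite_of_finite (ZMod 2)
        have := Fintype.ofFinite (Module.Dual (ZMod 2) A)
        rw [finprod_eq_prod_of_fintype]
        have : ∃ l : Module.Dual (ZMod 2) A, l (e p) ≠ 0 := by
          by_contra hc
          push Not at hc
          exact h (hsep _ _ fun l => by rw [hc, map_zero])
        obtain ⟨l, hl⟩ := this
        refine dvd_trans ?_ (Finset.dvd_prod_of_mem f (Finset.mem_univ l))
        by_contra hc
        rw [he p hp, multiplicity_eq_zero.mpr hc] at hl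
        exact hl rfl)
  have hge : ∀ (g : Grp) p, Prime p → e (g • p) = g • e p := by
    intro g p hp
    have hgp : Prime (g • p) :=
      (MulEquiv.prime_iff (MulSemiringAction.toRingEquiv Grp R g)).mpr hp
    refine hsep _ _ fun m => ?_
    let l : Module.Dual (ZMod 2) A := AddMonoidHom.toZModLinearMap 2
      (m.toAddMonoidHom.comp (DistribSMul.toAddMonoidHom A g))
    obtain ⟨d, n, hd, hn, h⟩ := hsmul g l m (fun a => by
      change m a = m (g • g⁻¹ • a); rw [smul_inv_smul])
    change m (e (g • p)) = l (e p)
    rw [he _ hgp, he _ hp, ← parity_of_sq hgp ((smul_ne_zero_iff_ne g).mpr (hf l)) (hf m) hd hn h]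
    congr 1
    exact multiplicity_map_eq (MulSemiringAction.toRingEquiv Grp R g)
  let F' : A → R := fun a => if a = 0 then 1 else F a
  have hF' : ∀ a, F' a ≠ 0 := fun a => by
    by_cases h : a = 0 <;> simp [F', h, hF]
  have hF'm : ∀ p, Prime p → ∀ a, multiplicity p (F' a) = if e p = a ∧ a ≠ 0 then 1 else 0 := by
    intro p hp a
    by_cases h : a = 0
    · simp only [F', h, if_pos, ne_eq, not_true, and_false, if_false]
      exact multiplicity_eq_zero.mpr fun h => hp.not_isUnit (isUnit_of_dvd_one h)
    · by_cases h' : e p = a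
      · rw [if_pos ⟨h', h⟩]; simpa only [F', if_neg h] using (hFm p hp a h).1 h'
      · rw [if_neg fun H => h' H.1]; simpa only [F', if_neg h] using (hFm p hp a h).2 h'
  refine ⟨F', hF', fun g a => ?_, fun l => ?_⟩
  · refine associated_of_multiplicity_eq ((smul_ne_zero_iff_ne g).mpr (hF' a)) (hF' _)
      fun p hp => ?_
    have hgp : Prime (g⁻¹ • p) :=
      (MulEquiv.prime_iff (MulSemiringAction.toRingEquiv Grp R g⁻¹)).mpr hp
    have h1 : multiplicity p (g • F' a) = multiplicity (g⁻¹ • p) (F' a) := by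
      have := multiplicity_map_eq (MulSemiringAction.toRingEquiv Grp R g) (a := g⁻¹ • p) (b := F' a)
      rw [← this]
      change _ = multiplicity (g • g⁻¹ • p) (g • F' a)
      rw [smul_inv_smul]
    rw [h1, hF'm _ hgp, hF'm _ hp, hge _ _ hp]
    refine if_congr (and_congr inv_smul_eq_iff ?_) rfl rfl
    rw [smul_ne_zero_iff_ne]
  · refine exists_eq_unit_mul_sq (mul_ne_zero (hf l)
      (Finset.prod_ne_zero_iff.mpr fun a _ => pow_ne_zero _ (hF' a))) fun p hp => ?_
    rw [← ZMod.natCast_eq_zero_iff_even, multiplicity_mul_of_ne_zero hp (hf l)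
      (Finset.prod_ne_zero_iff.mpr fun a _ => pow_ne_zero _ (hF' a)),
      multiplicity_prod_of_ne_zero hp _ _ (fun a _ => pow_ne_zero _ (hF' a)), Nat.cast_add,
      Nat.cast_sum, ← he p hp l]
    have : ∀ a, ((multiplicity p (F' a ^ (l a).val) : ℕ) : ZMod 2) =
        if e p = a then l a else 0 := by
      intro a
      rw [multiplicity_pow_of_ne_zero hp (hF' a), hF'm p hp]
      by_cases h : e p = a <;> by_cases h0 : a = 0 <;> simp [h, h0]
    rw [Finset.sum_congr rfl fun a _ => this a]
    simp [CharTwo.add_self_eq_zero]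

end

namespace Tower
open Grp
variable {K Ω Γ : Type*} [Field K] [Field Ω] [Group Γ] [MulSemiringAction Grp K]
    [MulSemiringAction Γ Ω] {T : Tower K Ω Γ}

theorem exists_character_vector {H : Subgroup Γ}
    (hsep : ∀ N : Subgroup Γ, H ≤ N → ∀ t ∉ N, ∃ z : Ω, (∀ n ∈ N, n • z = z) ∧ t • z ≠ z)
    (χ : Γ → ZMod 2) (hχ : ∀ κ κ', T.proj κ = 1 → T.proj κ' = 1 → χ (κ * κ') = χ κ + χ κ')
    (hH : ∀ κ ∈ H, T.proj κ = 1 ∧ χ κ = 0) :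
    ∃ w : Ω, w ≠ 0 ∧ ∀ κ, T.proj κ = 1 → κ • w = sgn Ω (χ κ) * w := by
  by_cases htriv : ∀ κ, T.proj κ = 1 → χ κ = 0
  · exact ⟨1, one_ne_zero, fun κ hκ => by rw [htriv κ hκ, smul_one, sgn_zero, one_mul]⟩
  push Not at htriv
  obtain ⟨t, ht, hχt⟩ := htriv
  replace hχt := (zmod2_cases (χ t)).resolve_left hχt
  have h1 : χ 1 = 0 := by
    have := hχ 1 1 (map_one _) (map_one _)
    rw [mul_one] at this
    exact left_eq_add.mp this
  let N : Subgroup Γ :=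
    { carrier := {κ | T.proj κ = 1 ∧ χ κ = 0}
      mul_mem' := fun {a b} ha hb => ⟨by rw [map_mul, ha.1, hb.1, one_mul],
        by rw [hχ a b ha.1 hb.1, ha.2, hb.2, add_zero]⟩
      one_mem' := ⟨map_one _, h1⟩
      inv_mem' := fun {a} ha => by
        have hp : T.proj a⁻¹ = 1 := by rw [map_inv, ha.1, inv_one]
        refine ⟨hp, ?_⟩
        have := hχ a a⁻¹ ha.1 hp
        rwa [mul_inv_cancel, h1, ha.2, zero_add, eq_comm] at this }
  have hN : ∀ κ, κ ∈ N ↔ T.proj κ = 1 ∧ χ κ = 0 := fun _ => Iff.rfl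
  have htN : t ∉ N := fun h => by
    rw [hN, hχt] at h
    exact one_ne_zero h.2
  obtain ⟨z, hz, hzt⟩ := hsep N (fun κ h => hH κ h) t htN
  have htt : ∀ κ, T.proj κ = 1 → χ κ = 1 → κ • z = t • z ∧ κ • t • z = z := by
    intro κ hκ hχκ
    have e1 : t⁻¹ * κ ∈ N := by
      have h2 := hχ t (t⁻¹ * κ) ht (by simp [ht, hκ])
      rw [mul_inv_cancel_left, hχκ, hχt] at h2
      exact ⟨by simp [ht, hκ], left_eq_add.mp h2⟩
    have e2 : κ * t ∈ N := ⟨by simp [ht, hκ], by rw [hχ κ t hκ ht, hχκ, hχt]; rfl⟩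
    constructor
    · have := hz _ e1
      rwa [mul_smul, inv_smul_eq_iff] at this
    · rw [← mul_smul]; exact hz _ e2
  have h0 : ∀ κ, T.proj κ = 1 → χ κ = 0 → κ • z = z ∧ κ • t • z = t • z := by
    intro κ hκ hχκ
    refine ⟨hz κ ⟨hκ, hχκ⟩, ?_⟩
    rw [← mul_smul]
    exact (htt (κ * t) (by simp [hκ, ht]) (by rw [hχ κ t hκ ht, hχκ, hχt, zero_add])).1
  refine ⟨z - t • z, sub_ne_zero.mpr (Ne.symm hzt), fun κ hκ => ?_⟩
  rw [smul_sub]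
  rcases zmod2_cases (χ κ) with h | h
  · rw [(h0 κ hκ h).1, (h0 κ hκ h).2, h, sgn_zero, one_mul]
  · rw [(htt κ hκ h).1, (htt κ hκ h).2, h, sgn_one]; ring

variable {R : Type*} [CommRing R] [IsDomain R] [Algebra R K] [IsFractionRing R K]

/-- Elements with the same quadratic character differ by a square. -/
theorem sq_class_eq (hfix : ∀ w : Ω, (∀ κ, T.proj κ = 1 → κ • w = w) → ∃ k, w = T.emb k)
    {χ : Γ → ZMod 2} {a b : R} {w w' : Ω} (hw : w ≠ 0) (hw' : w' ≠ 0)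
    (h : w ^ 2 = T.emb (algebraMap R K a)) (h' : w' ^ 2 = T.emb (algebraMap R K b))
    (hχ : ∀ κ, T.proj κ = 1 → κ • w = sgn Ω (χ κ) * w)
    (hχ' : ∀ κ, T.proj κ = 1 → κ • w' = sgn Ω (χ κ) * w') :
    ∃ d n : R, d ≠ 0 ∧ n ≠ 0 ∧ a * d ^ 2 = b * n ^ 2 := by
  obtain ⟨k, hk⟩ := hfix (w / w') fun κ hκ => by
    rw [div_eq_mul_inv, smul_mul', smul_inv'', hχ κ hκ, hχ' κ hκ,
      ← div_eq_mul_inv, mul_div_mul_left _ _ (sgn_ne_zero _), div_eq_mul_inv]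
  obtain ⟨n, d, hd, rfl⟩ := IsFractionRing.div_surjective (A := R) k
  have hd0 : algebraMap R K d ≠ 0 := by
    simpa using nonZeroDivisors.ne_zero hd
  refine ⟨d, n, nonZeroDivisors.ne_zero hd, ?_, ?_⟩
  · rintro rfl
    rw [map_zero, zero_div, map_zero] at hk
    exact div_ne_zero hw hw' hk
  · apply IsFractionRing.injective R K
    apply T.emb.injective
    have hd1 : T.emb (algebraMap R K d) ≠ 0 := (map_ne_zero _).mpr hd0
    rw [map_div₀, div_eq_div_iff hw' hd1] at hk
    simp only [map_mul, map_pow]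
    rw [← h, ← h', ← mul_pow, ← mul_pow, hk]; ring

variable [UniqueFactorizationMonoid R] [MulSemiringAction Grp R]
  {A : Type*} [Fintype A] [AddCommGroup A] [Module (ZMod 2) A] [DistribMulAction Grp A]

theorem kap_pow {κ : Γ} (hκ : T.proj κ = 1) {k : K} (hk : k ≠ 0) (n : ℕ) :
    T.kap κ (k ^ n) = n * T.kap κ k := by
  induction n with
  | zero => simpa using kap_one hκ
  | succ n ih => rw [pow_succ, kap_mul hκ (pow_ne_zero n hk) hk, ih]; push_cast; ring

/-- An equivariant character of the kernel is a sum of Kummer symbols. -/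
theorem exists_kapSum (halg : ∀ (g : Grp) (r : R), algebraMap R K (g • r) = g • algebraMap R K r)
    (hunit : ∀ v : R, IsUnit v → ∃ z : ℂ, z ≠ 0 ∧ algebraMap R K v = T.const z)
    (hsurj : Function.Surjective T.proj)
    (hfix : ∀ w : Ω, (∀ κ, T.proj κ = 1 → κ • w = w) → ∃ k, w = T.emb k)
    {H : Subgroup Γ}
    (hsep : ∀ N : Subgroup Γ, H ≤ N → ∀ t ∉ N, ∃ z : Ω, (∀ n ∈ N, n • z = z) ∧ t • z ≠ z)
    (c : Γ → A) (hc : ∀ κ κ', T.proj κ = 1 → T.proj κ' = 1 → c (κ * κ') = c κ + c κ')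
    (hcg : ∀ γ κ, T.proj κ = 1 → c (γ * κ * γ⁻¹) = T.proj γ • c κ)
    (hH : ∀ κ ∈ H, T.proj κ = 1 ∧ c κ = 0) :
    ∃ F : A → K, (∀ a, F a ≠ 0) ∧ (∀ (g : Grp) a, T.CE (F (g • a)) (g • F a)) ∧
      ∀ κ, T.proj κ = 1 → c κ = T.kapSum κ F := by
  have hex : ∀ l : Module.Dual (ZMod 2) A, ∃ w : Ω, ∃ r : R, r ≠ 0 ∧
      w ^ 2 = T.emb (algebraMap R K r) ∧
      ∀ κ, T.proj κ = 1 → κ • w = sgn Ω (l (c κ)) * w := by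
    intro l
    obtain ⟨w, hw, hχ⟩ := exists_character_vector (T := T) hsep (fun κ => l (c κ))
      (fun κ κ' h h' => by simp only [hc κ κ' h h', map_add])
      (fun κ h => ⟨(hH κ h).1, by simp only [(hH κ h).2, map_zero]⟩)
    obtain ⟨k, hk⟩ := hfix (w ^ 2) fun κ hκ => by
      rw [smul_pow', hχ κ hκ, mul_pow, sq (sgn Ω _), sgn_mul_self, one_mul]
    have hk0 : k ≠ 0 := by
      rintro rfl
      rw [map_zero] at hk
      exact pow_ne_zero 2 hw hk
    obtain ⟨n, d, hd, rfl⟩ := IsFractionRing.div_surjective (A := R) k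
    have hd0 : algebraMap R K d ≠ 0 := by
      simpa using nonZeroDivisors.ne_zero hd
    refine ⟨w * T.emb (algebraMap R K d), n * d, ?_, ?_, ?_⟩
    · rintro h
      rcases mul_eq_zero.mp h with rfl | rfl
      · simp at hk0
      · simp at hd0
    · rw [mul_pow, hk, ← map_pow, ← map_mul T.emb, map_mul (algebraMap R K)]
      congr 1
      field_simp
    · intro κ hκ
      rw [smul_mul', smul_emb, hκ, one_smul, hχ κ hκ, mul_assoc]
  choose w f hf hw hχ using hex
  have hf' : ∀ l, algebraMap R K (f l) ≠ 0 := fun l => by simpa using hf l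
  have hw0 : ∀ l, w l ≠ 0 := fun l => ne_zero_of_sq (hf' l) (hw l)
  obtain ⟨F, hF, hFg, hFl⟩ := exists_equivariant_family f hf (fun l m => by
      refine sq_class_eq hfix (χ := fun κ => (l + m) (c κ)) (hw0 (l + m))
        (mul_ne_zero (hw0 l) (hw0 m)) (hw _) ?_ (hχ _) fun κ hκ => ?_
      · rw [mul_pow, hw, hw, map_mul, map_mul]
      · rw [smul_mul', hχ l κ hκ, hχ m κ hκ, LinearMap.add_apply, sgn_add]; ring)
    (fun g l m hm => by
      obtain ⟨γ, rfl⟩ := hsurj g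
      refine sq_class_eq hfix (χ := fun κ => m (c κ)) (w := γ • w l)
        ((smul_ne_zero_iff_ne γ).mpr (hw0 l)) (hw0 m) ?_ (hw _) (fun κ hκ => ?_) (hχ _)
      · rw [smul_sq (hw l), halg]
      · have e : κ * γ = γ * (γ⁻¹ * κ * γ⁻¹⁻¹) := by group
        rw [← mul_smul, e, mul_smul, hχ l _ (by simp [hκ]), smul_mul', smul_sgn, hcg _ _ hκ, hm,
          map_inv])
  have hF' : ∀ a, algebraMap R K (F a) ≠ 0 := fun a => by simpa using hF a
  refine ⟨fun a => algebraMap R K (F a), hF', fun g a => ?_, fun κ hκ => ?_⟩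
  · obtain ⟨v, hv⟩ := (hFg g a).symm
    obtain ⟨z, hz, hvz⟩ := hunit v v.isUnit
    exact ⟨z, hz, by rw [← halg, ← hv, map_mul, hvz, mul_comm]⟩
  · apply (Module.evalEquiv (ZMod 2) A).injective
    ext l
    change l (c κ) = l (T.kapSum κ _)
    have e1 : T.kap κ (algebraMap R K (f l)) = l (c κ) := kap_eq hκ (hf' l) (hw l) (hχ l κ hκ)
    obtain ⟨v, s, hv, hs, h⟩ := hFl l
    obtain ⟨z, hz, hvz⟩ := hunit v hv
    have h2 := congrArg (fun r => T.kap κ (algebraMap R K r)) h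
    simp only [map_mul, map_prod, map_pow, hvz] at h2
    have hs' : algebraMap R K s ≠ 0 := by simpa using hs
    rw [kap_mul hκ (hf' l) (Finset.prod_ne_zero_iff.mpr fun a _ => pow_ne_zero _ (hF' a)),
      kap_prod hκ _ _ (fun a _ => pow_ne_zero _ (hF' a)),
      kap_mul hκ (by simpa using hz) (pow_ne_zero 2 hs'), kap_const hκ hz, kap_sq hκ hs', e1,
      add_zero, CharTwo.add_eq_zero] at h2
    rw [h2, ← LinearMap.toAddMonoidHom_coe, map_kapSum]
    refine Finset.sum_congr rfl fun a _ => ?_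
    rw [kap_pow hκ (hF' a), ZMod.natCast_val, ZMod.cast_id, mul_comm]

end Tower

/-- Points outside an open subgroup of a Galois group move some fixed vector. -/
theorem exists_moved_of_notMem {F Ω : Type*} [Field F] [Field Ω] [Algebra F Ω] [IsGalois F Ω]
    (N : Subgroup (Ω ≃ₐ[F] Ω)) (hN : IsOpen (N : Set (Ω ≃ₐ[F] Ω))) {t : Ω ≃ₐ[F] Ω} (ht : t ∉ N) :
    ∃ z : Ω, (∀ n ∈ N, n • z = z) ∧ t • z ≠ z := by
  have hcl : IsClosed (N : Set (Ω ≃ₐ[F] Ω)) := N.isClosed_of_isOpen hN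
  by_contra hc
  push Not at hc
  apply ht
  have := InfiniteGalois.fixingSubgroup_fixedField (⟨N, hcl⟩ : ClosedSubgroup (Ω ≃ₐ[F] Ω))
  change (IntermediateField.fixedField N).fixingSubgroup = N at this
  rw [← this, IntermediateField.mem_fixingSubgroup_iff]
  intro z hz
  exact hc z fun n hn => (IntermediateField.mem_fixedField_iff _ _).mp hz n hn

/-- A finite Galois group is a quotient of the Galois group of a larger Galois extension. -/
theorem exists_proj_of_algHom {F K Ω G : Type*} [Field F] [Field K] [Field Ω] [Algebra F K]
    [Algebra F Ω] [IsGalois F Ω] [FiniteDimensional F K] [IsGalois F K] [Group G]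
    (e : G ≃* (K ≃ₐ[F] K)) (emb : K →ₐ[F] Ω) :
    ∃ proj : (Ω ≃ₐ[F] Ω) →* G, Function.Surjective proj ∧
      IsOpen (proj.ker : Set (Ω ≃ₐ[F] Ω)) ∧
      (∀ γ k, γ (emb k) = emb (e (proj γ) k)) ∧
      ∀ w, (∀ κ, proj κ = 1 → κ w = w) → ∃ k, w = emb k := by
  let : Algebra K Ω := emb.toRingHom.toAlgebra
  have : IsScalarTower F K Ω := IsScalarTower.of_algebraMap_eq fun r => (emb.commutes r).symm
  let res : (Ω ≃ₐ[F] Ω) →* (K ≃ₐ[F] K) := AlgEquiv.restrictNormalHom K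
  let proj : (Ω ≃ₐ[F] Ω) →* G := e.symm.toMonoidHom.comp res
  have hproj : ∀ γ k, γ (emb k) = emb (e (proj γ) k) := by
    intro γ k
    have h : e (proj γ) = res γ := e.apply_symm_apply _
    rw [h]
    exact (γ.restrictNormal_commutes K k).symm
  have hfix : ∀ κ, κ ∈ emb.fieldRange.fixingSubgroup ↔ proj κ = 1 := by
    intro κ
    rw [IntermediateField.mem_fixingSubgroup_iff]
    constructor
    · intro h
      refine e.injective (AlgEquiv.ext fun k => emb.injective ?_)
      rw [map_one]
      exact (hproj κ k).symm.trans (h _ ⟨k, rfl⟩)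
    · rintro h _ ⟨k, rfl⟩
      have := hproj κ k
      rwa [h, map_one] at this
  refine ⟨proj, ?_, ?_, hproj, fun w hw => ?_⟩
  · exact e.symm.surjective.comp (AlgEquiv.restrictNormalHom_surjective Ω)
  · have : FiniteDimensional F emb.fieldRange :=
      LinearEquiv.finiteDimensional (AlgEquiv.ofInjectiveField emb).toLinearEquiv
    convert emb.fieldRange.fixingSubgroup_isOpen using 1
    ext κ
    exact (hfix κ).symm
  · have : w ∈ IntermediateField.fixedField emb.fieldRange.fixingSubgroup := by
      rw [IntermediateField.mem_fixedField_iff]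
      exact fun κ hκ => hw κ ((hfix κ).mp hκ)
    rw [InfiniteGalois.fixedField_fixingSubgroup] at this
    obtain ⟨k, hk⟩ := this
    exact ⟨k, hk.symm⟩

/-- A finite group action on a field is seen by the absolute Galois group of the fixed field. -/
theorem exists_proj (G K : Type) [Group G] [Finite G] [Field K] [MulSemiringAction G K]
    [FaithfulSMul G K] :
    ∃ (emb : K →+* SeparableClosure (FixedPoints.subfield G K))
      (proj : AbsGal (FixedPoints.subfield G K) →* G),
      Function.Surjective proj ∧ IsOpen (proj.ker : Set (AbsGal (FixedPoints.subfield G K))) ∧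
      (∀ (γ : AbsGal (FixedPoints.subfield G K)) k, γ • emb k = emb (proj γ • k)) ∧
      ∀ w, (∀ κ : AbsGal (FixedPoints.subfield G K), proj κ = 1 → κ • w = w) →
        ∃ k, w = emb k := by
  let emb : K →ₐ[FixedPoints.subfield G K] SeparableClosure (FixedPoints.subfield G K) :=
    IsSepClosed.lift
  obtain ⟨proj, h⟩ := exists_proj_of_algHom (FixedPoints.toAlgAutMulEquiv G K) emb
  exact ⟨emb, proj, h⟩

namespace Grp

/-- The action of a group element on the constants, as a ring homomorphism. -/
noncomputable def conjHom (g : Grp) : ℂ →+* ℂ :=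
  if g.u1 = 0 then RingHom.id ℂ else starRingEnd ℂ

theorem conjHom_apply (g : Grp) (z : ℂ) : g.conjHom z = g.conj z := by
  unfold conjHom conj; split_ifs <;> rfl

theorem conjHom_mul (g h : Grp) : (g * h).conjHom = g.conjHom.comp h.conjHom := by
  ext z
  rw [RingHom.comp_apply, conjHom_apply, conjHom_apply, conjHom_apply]
  unfold conj
  rw [u1_mul]
  have e : (1 : ZMod 2) + 1 = 0 := rfl
  rcases zmod2_cases g.u1 with hg | hg <;> rcases zmod2_cases h.u1 with hh | hh <;>
    simp [hg, hh, e]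

/-- Polynomials with variables indexed by the group. -/
abbrev Poly : Type := MvPolynomial Grp ℂ

/-- The semilinear action of the group on polynomials. -/
noncomputable def polyHom : Grp →* (Poly →+* Poly) where
  toFun g := MvPolynomial.eval₂Hom (MvPolynomial.C.comp g.conjHom) fun h => MvPolynomial.X (g * h)
  map_one' := by
    refine MvPolynomial.ringHom_ext (fun z => ?_) fun h => ?_
    · simp [conjHom_apply, conj]
    · simp
  map_mul' g h := by
    refine MvPolynomial.ringHom_ext (fun z => ?_) fun k => ?_
    · simp [conjHom_mul]
    · simp [mul_assoc]

noncomputable instance : MulSemiringAction Grp Poly := MulSemiringAction.compHom Poly polyHom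

theorem smul_C (g : Grp) (z : ℂ) : g • (MvPolynomial.C z : Poly) = MvPolynomial.C (g.conj z) := by
  change polyHom g (MvPolynomial.C z) = _
  simp [polyHom, conjHom_apply]

theorem smul_X (g h : Grp) : g • (MvPolynomial.X h : Poly) = MvPolynomial.X (g * h) := by
  change polyHom g (MvPolynomial.X h) = _
  simp [polyHom]

instance : FaithfulSMul Grp Poly := ⟨fun {g h} e => by
  have := e (MvPolynomial.X 1)
  rw [smul_X, smul_X, mul_one, mul_one] at this
  exact MvPolynomial.X_injective this⟩

/-- Rational functions with variables indexed by the group. -/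
abbrev Rat : Type := FractionRing Poly

noncomputable instance : MulSemiringAction Grp Rat :=
  IsFractionRing.mulSemiringAction Grp Poly Rat

theorem algebraMap_smul (g : Grp) (r : Poly) :
    algebraMap Poly Rat (g • r) = g • algebraMap Poly Rat r :=
  (IsFractionRing.ringEquivOfRingEquiv_algebraMap (K := Rat) (L := Rat)
    (MulSemiringAction.toRingEquiv Grp Poly g) r).symm

instance : FaithfulSMul Grp Rat := ⟨fun {g h} e => by
  refine eq_of_smul_eq_smul (α := Poly) fun r => IsFractionRing.injective Poly Rat ?_
  rw [algebraMap_smul, algebraMap_smul, e]⟩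

end Grp

open Grp

/-- The base field of the example. -/
abbrev BaseField : Type := FixedPoints.subfield Grp Grp.Rat

/-- The constants inside the rational functions. -/
noncomputable def constHom : ℂ →+* Grp.Rat := (algebraMap Poly Grp.Rat).comp MvPolynomial.C

theorem exists_tower : ∃ T : Tower Grp.Rat (SeparableClosure BaseField) (AbsGal BaseField),
    T.const = constHom ∧ Function.Surjective T.proj ∧
      IsOpen (T.proj.ker : Set (AbsGal BaseField)) ∧
      ∀ w, (∀ κ, T.proj κ = 1 → κ • w = w) → ∃ k, w = T.emb k := by
  obtain ⟨emb, proj, hsurj, hopen, hemb, hfix⟩ := exists_proj Grp Grp.Rat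
  have : CharZero (SeparableClosure BaseField) :=
    charZero_of_injective_ringHom (emb.comp constHom).injective
  refine ⟨⟨emb, proj, constHom, hemb, fun g z => ?_, fun k =>
    IsSepClosed.exists_pow_nat_eq (emb k) 2⟩, rfl, hsurj, hopen, hfix⟩
  change g • algebraMap Poly Grp.Rat (MvPolynomial.C z) =
    algebraMap Poly Grp.Rat (MvPolynomial.C (g.conj z))
  rw [← algebraMap_smul, smul_C]

theorem isUnit_poly (v : Poly) (hv : IsUnit v) :
    ∃ z : ℂ, z ≠ 0 ∧ algebraMap Poly Grp.Rat v = constHom z := by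
  obtain ⟨z, hz, rfl⟩ := MvPolynomial.isUnit_iff_eq_C_of_isReduced.mp hv
  exact ⟨z, hz.ne_zero, rfl⟩

namespace Tower
open Grp
variable {K Ω Γ : Type*} [Field K] [Field Ω] [Group Γ] [MulSemiringAction Grp K]
    [MulSemiringAction Γ Ω] {T : Tower K Ω Γ}

/-- The values on the kernel of the projection of a lift modulo 4. -/
theorem exists_kernel_character (Φ : Γ →* Mat54) (hΦ : ∀ γ, redM (Φ γ) = matHom (T.proj γ)) :
    ∃ c : Γ → Mat5, ∀ κ, T.proj κ = 1 → Φ κ = 1 + dblM (c κ) := by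
  have h : ∀ κ, ∃ a : Mat5, T.proj κ = 1 → Φ κ = 1 + dblM a := by
    intro κ
    by_cases hκ : T.proj κ = 1
    · obtain ⟨a, ha⟩ := exists_dblM (Φ κ - 1) (by
        rw [map_sub, hΦ, hκ, map_one, map_one, sub_self])
      exact ⟨a, fun _ => by rw [← ha, add_sub_cancel]⟩
    · exact ⟨0, fun h => absurd h hκ⟩
  choose c hc using h
  exact ⟨c, hc⟩

theorem one_add_dblM_injective {a b : Mat5} (h : 1 + dblM a = 1 + dblM b) : a = b :=
  dblM_injective (add_left_cancel h)

theorem kernel_character_conj {Φ : Γ →* Mat54} (hΦ : ∀ γ, redM (Φ γ) = matHom (T.proj γ))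
    {c : Γ → Mat5} (hc : ∀ κ, T.proj κ = 1 → Φ κ = 1 + dblM (c κ)) (γ κ : Γ)
    (hκ : T.proj κ = 1) : c (γ * κ * γ⁻¹) = T.proj γ • c κ := by
  refine one_add_dblM_injective ?_
  rw [← hc _ (by rw [map_mul, map_mul, hκ, mul_one, map_inv, mul_inv_cancel]), map_mul, map_mul,
    hc κ hκ, mul_add, add_mul, mul_one, mul_dblM, dblM_mul, hΦ, hΦ, ← map_mul Φ, mul_inv_cancel,
    map_one, map_inv]
  rfl

/-- A lift modulo 4 whose Kummer characters are controlled by a polynomial ring cannot exist. -/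
theorem no_lift {R : Type*} [CommRing R] [IsDomain R] [UniqueFactorizationMonoid R] [Algebra R K]
    [IsFractionRing R K] [MulSemiringAction Grp R]
    (halg : ∀ (g : Grp) (r : R), algebraMap R K (g • r) = g • algebraMap R K r)
    (hunit : ∀ v : R, IsUnit v → ∃ z : ℂ, z ≠ 0 ∧ algebraMap R K v = T.const z)
    (hsurj : Function.Surjective T.proj)
    (hfix : ∀ w : Ω, (∀ κ, T.proj κ = 1 → κ • w = w) → ∃ k, w = T.emb k)
    {H : Subgroup Γ}
    (hsep : ∀ N : Subgroup Γ, H ≤ N → ∀ t ∉ N, ∃ z : Ω, (∀ n ∈ N, n • z = z) ∧ t • z ≠ z)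
    (Φ : Γ →* Mat54) (hΦ : ∀ γ, redM (Φ γ) = matHom (T.proj γ))
    (hH : ∀ κ ∈ H, T.proj κ = 1 ∧ Φ κ = 1) : False := by
  obtain ⟨c, hc⟩ := exists_kernel_character (T := T) Φ hΦ
  obtain ⟨F, hF, hFg, hcF⟩ := exists_kapSum halg hunit hsurj hfix hsep c
    (fun κ κ' h h' => one_add_dblM_injective (by
      rw [← hc _ (by rw [map_mul, h, h', mul_one]), map_mul, hc _ h, hc _ h', one_add_dblM_mul]))
    (kernel_character_conj hΦ hc)
    (fun κ h => ⟨(hH κ h).1, one_add_dblM_injective (by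
      rw [← hc κ (hH κ h).1, (hH κ h).2, map_zero, add_zero])⟩)
  obtain ⟨σ, hσ⟩ := hsurj x
  obtain ⟨τ, hτ⟩ := hsurj y
  have k := kapSum_relation hσ hτ F hF hFg
  rw [← hcF _ (proj_r1 hσ), ← hcF _ (proj_r4 hσ hτ), ← hcF _ (proj_r5 hσ hτ)] at k
  have e := lift_relation (M := Φ σ) (N := Φ τ) (by rw [hΦ, hσ]) (by rw [hΦ, hτ])
    (c1 := c (σ * σ * σ * σ)) (c4 := c (σ * σ * τ * (σ * σ)⁻¹ * τ⁻¹))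
    (c5 := c (σ * (τ * τ) * σ⁻¹ * (τ * τ)⁻¹))
    (by rw [← hc _ (proj_r1 hσ)]; simp only [map_mul])
    (by rw [← hc _ (proj_r4 hσ hτ)]; simp only [← map_mul]; congr 1; group)
    (by rw [← hc _ (proj_r5 hσ hτ)]; simp only [← map_mul]; congr 1; group)
  rw [k] at e
  exact zero_ne_one e
end Tower

theorem stmt_7 :
    ∃ (F : Type) (_ : Field F),
      ∃ ρ : AbsGal F →* GL (Fin 5) (ZMod 2),
        IsOpen (ρ.ker : Set (AbsGal F)) ∧
        ¬ ∃ ρ₂ : AbsGal F →* GL (Fin 5) (ZMod 4),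
            IsOpen (ρ₂.ker : Set (AbsGal F)) ∧
            (Matrix.GeneralLinearGroup.map
              (ZMod.castHom (by norm_num : (2 : ℕ) ∣ 4) (ZMod 2))).comp ρ₂ = ρ := by
  obtain ⟨T, hconst, hsurj, hopen, hfix⟩ := exists_tower
  refine ⟨BaseField, inferInstance, (Grp.matHom.toHomUnits).comp T.proj, ?_, ?_⟩
  · refine Subgroup.isOpen_mono (H₁ := T.proj.ker) (fun γ h => ?_) hopen
    rw [MonoidHom.mem_ker] at h ⊢
    rw [MonoidHom.comp_apply, h, map_one]
  · rintro ⟨ρ₂, hρ₂, h⟩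
    refine T.no_lift (R := Grp.Poly) Grp.algebraMap_smul (fun v hv => hconst ▸ isUnit_poly v hv)
      hsurj hfix (H := ρ₂.ker ⊓ T.proj.ker)
      (fun N hN t ht => exists_moved_of_notMem N (Subgroup.isOpen_mono hN (hρ₂.inter hopen)) ht)
      ((Units.coeHom _).comp ρ₂) (fun γ => ?_) (fun κ hκ => ⟨hκ.2, ?_⟩)
    · exact congrArg Units.val (DFunLike.congr_fun h γ)
    · have : ρ₂ κ = 1 := hκ.1
      rw [MonoidHom.comp_apply, this, map_one]
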